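/- arXiv:2412.09145 — 4 statements merged into one kernel-verified Lean document; each statement's English description precedes it below -/
import Mathlib

section
/- Let a > 1 and b > 0 be reals, let d ≥ 0 be a real and m ≥ 0 an integer, and set δ_a := 1 if a is an integer and δ_a := 0 otherwise. Let (v_k)_{k≥2} be real numbers with |v_k| ≤ C₀ (log k)^d / k^a for all k ≥ 2 and some C₀ > 0. Then there exist polynomials K₀, …, K_{⌊a⌋−1} with real coefficients, where K_ν has degree at most ν, and a constant C₁ > 0 such that for all integers n ≥ 4 and all reals z, |Σ_{k=2}^{⌊n/2⌋} z^m · v_k · (n−k)^{−b} · e^{−z²/(2(n−k))} − (z^m/n^b) · e^{−z²/(2n)} · Σ_{ν=0}^{⌊a⌋−1} K_ν(z²/n) · n^{−ν}| ≤ C₁ (log n)^{d+δ_a} / n^{a+b−m/2−1}. -/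
open Finset Real
open scoped Classical

lemma exists_exp_neg_taylor_bound (M : ℕ) :
    ∃ C : ℝ, 0 ≤ C ∧ ∀ t : ℝ, 0 ≤ t →
      |exp (-t) - ∑ j ∈ range M, (-t) ^ j / (j.factorial : ℝ)| ≤ C * t ^ M := by
  refine ⟨exp 1 + M + 1, by positivity, fun t ht => ?_⟩
  have htM : 0 ≤ t ^ M := by positivity
  rcases le_total t 1 with h1 | h1
  · have h := Complex.norm_exp_sub_sum_le_norm_mul_exp ((-t : ℝ) : ℂ) M
    have e : Complex.exp ((-t : ℝ) : ℂ) - ∑ m ∈ range M, ((-t : ℝ) : ℂ) ^ m / (m.factorial : ℂ)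
        = ((exp (-t) - ∑ j ∈ range M, (-t) ^ j / (j.factorial : ℝ) : ℝ) : ℂ) := by
      push_cast; rfl
    rw [e, Complex.norm_real, Complex.norm_real, norm_eq_abs, norm_eq_abs, abs_neg,
      abs_of_nonneg ht] at h
    have h2 : exp t ≤ exp 1 := exp_le_exp.mpr h1
    have h3 : (0 : ℝ) ≤ M := by positivity
    nlinarith [mul_le_mul_of_nonneg_left h2 htM, mul_nonneg h3 htM]
  · have hsum : |∑ j ∈ range M, (-t) ^ j / (j.factorial : ℝ)| ≤ M * t ^ M := by
      calc _ ≤ ∑ j ∈ range M, |(-t) ^ j / (j.factorial : ℝ)| := abs_sum_le_sum_abs _ _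
        _ ≤ ∑ j ∈ range M, t ^ M := by
            refine sum_le_sum fun j hj => ?_
            rw [abs_div, abs_pow, abs_neg, abs_of_nonneg ht, Nat.abs_cast]
            have hf : (1 : ℝ) ≤ j.factorial := by exact_mod_cast j.factorial_pos
            exact (div_le_self (by positivity) hf).trans
              (pow_le_pow_right₀ h1 (mem_range.mp hj).le)
        _ = M * t ^ M := by simp
    have hexp : |exp (-t)| ≤ t ^ M := by
      rw [abs_of_pos (exp_pos _)]
      exact (exp_le_one_iff.mpr (by linarith)).trans (one_le_pow₀ h1)
    calc _ ≤ |exp (-t)| + |∑ j ∈ range M, (-t) ^ j / (j.factorial : ℝ)| := abs_sub _ _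
      _ ≤ t ^ M + M * t ^ M := add_le_add hexp hsum
      _ ≤ _ := by nlinarith [mul_nonneg (exp_pos 1).le htM]

lemma exists_one_sub_rpow_taylor_bound (c : ℝ) {M : ℕ} (hM : 0 < M) :
    ∃ (q : ℕ → ℝ) (C : ℝ), 0 ≤ C ∧ ∀ x : ℝ, 0 ≤ x → x ≤ 1 / 2 →
      |(1 - x) ^ (-c) - ∑ i ∈ range M, q i * x ^ i| ≤ C * x ^ M := by
  obtain ⟨N, rfl⟩ : ∃ N, M = N + 1 := ⟨M - 1, by omega⟩
  have hf : ContDiffOn ℝ (N + 1) (fun x : ℝ => (1 - x) ^ (-c)) (Set.Icc 0 (1 / 2)) := by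
    refine ContDiffOn.rpow_const_of_ne (by fun_prop) fun x hx => ?_
    have := hx.2
    linarith
  obtain ⟨C, hC⟩ := exists_taylor_mean_remainder_bound (by norm_num) hf
  refine ⟨fun k => (k.factorial : ℝ)⁻¹ * iteratedDerivWithin k (fun x : ℝ => (1 - x) ^ (-c))
    (Set.Icc 0 (1 / 2)) 0, |C|, abs_nonneg _, fun x hx0 hx => ?_⟩
  have h := hC x ⟨hx0, hx⟩
  rw [taylor_within_apply, norm_eq_abs, sub_zero] at h
  refine le_trans (le_of_eq ?_) (h.trans ?_)
  · congr 2
    refine sum_congr rfl fun k _ => ?_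
    simp only [smul_eq_mul]
    ring
  · gcongr
    exact le_abs_self C

lemma exists_polynomial_eval_bound (p : Polynomial ℝ) {M : ℕ} (hp : p.natDegree ≤ M) :
    ∃ C : ℝ, 0 ≤ C ∧ ∀ w : ℝ, 0 ≤ w → |p.eval w| ≤ C * (1 + w) ^ M := by
  refine ⟨∑ i ∈ range (M + 1), |p.coeff i|, by positivity, fun w hw => ?_⟩
  rw [Polynomial.eval_eq_sum_range' (Nat.lt_succ_of_le hp), sum_mul]
  refine (abs_sum_le_sum_abs _ _).trans (sum_le_sum fun i hi => ?_)
  rw [abs_mul, abs_pow, abs_of_nonneg hw]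
  gcongr
  calc w ^ i ≤ (1 + w) ^ i := by gcongr; linarith
    _ ≤ (1 + w) ^ M := pow_le_pow_right₀ (by linarith) (Nat.lt_succ_iff.mp (mem_range.mp hi))

/-- Taylor expansion in `x` of the kernel `(1 - x)^(-b) * exp (-(w / 2) * (x / (1 - x)))`,
uniformly in `w ≥ 0`. -/
lemma exists_kernel_taylor_bound {b : ℝ} (hb : 0 < b) (M : ℕ) :
    ∃ (P : ℕ → Polynomial ℝ) (C : ℝ), 0 ≤ C ∧ (∀ ν, (P ν).natDegree ≤ ν) ∧
      ∀ x w : ℝ, 0 ≤ x → x ≤ 1 / 2 → 0 ≤ w →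
        |(1 - x) ^ (-b) * exp (-(w / 2 * (x / (1 - x)))) -
          ∑ ν ∈ range M, (P ν).eval w * x ^ ν| ≤ C * x ^ M * (1 + w) ^ M := by
  obtain ⟨A, hA0, hA⟩ := exists_exp_neg_taylor_bound M
  have hbin : ∀ j : ℕ, ∃ (q : ℕ → ℝ) (C : ℝ), 0 ≤ C ∧ (j < M → ∀ x : ℝ, 0 ≤ x → x ≤ 1 / 2 →
      |(1 - x) ^ (-(b + j)) - ∑ i ∈ range (M - j), q i * x ^ i| ≤ C * x ^ (M - j)) := by
    intro j
    by_cases hj : j < M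
    · obtain ⟨q, C, hC, h⟩ := exists_one_sub_rpow_taylor_bound (b + j) (Nat.sub_pos_of_lt hj)
      exact ⟨q, C, hC, fun _ => h⟩
    · exact ⟨0, 0, le_rfl, fun h => absurd h hj⟩
  choose q B hB0 hB using hbin
  refine ⟨fun ν => ∑ j ∈ range (ν + 1),
      Polynomial.C ((-(1 / 2)) ^ j / (j.factorial : ℝ) * q j (ν - j)) * Polynomial.X ^ j,
    2 ^ b * A + ∑ j ∈ range M, B j, ?_, ?_, ?_⟩
  · have := sum_nonneg fun j (_ : j ∈ range M) => hB0 j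
    positivity
  · intro ν
    refine Polynomial.natDegree_sum_le_of_forall_le _ _ fun j hj => ?_
    exact (Polynomial.natDegree_C_mul_X_pow_le _ _).trans (Nat.lt_succ_iff.mp (mem_range.mp hj))
  · intro x w hx0 hx hw
    have h1x : 0 < 1 - x := by linarith
    set y := x / (1 - x) with hy
    have hy0 : 0 ≤ y := by positivity
    have hy2 : y ≤ 2 * x := by
      rw [hy, div_le_iff₀ h1x]; nlinarith
    set g := (1 - x) ^ (-b) with hg
    have hg0 : 0 ≤ g := by positivity
    have hg2 : g ≤ 2 ^ b := by
      rw [hg, rpow_neg h1x.le, ← inv_rpow h1x.le]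
      refine rpow_le_rpow (by positivity) ?_ hb.le
      rw [inv_le_comm₀ h1x (by norm_num)]; linarith
    have hpoly : ∑ ν ∈ range M, (∑ j ∈ range (ν + 1),
        Polynomial.C ((-(1 / 2)) ^ j / (j.factorial : ℝ) * q j (ν - j)) *
          Polynomial.X ^ j).eval w * x ^ ν
        = ∑ j ∈ range M, (-(w / 2)) ^ j / (j.factorial : ℝ) * x ^ j *
            ∑ i ∈ range (M - j), q j i * x ^ i := by
      have h := sum_range_diag_flip M fun j i =>
        (-(w / 2)) ^ j / (j.factorial : ℝ) * x ^ j * (q j i * x ^ i)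
      simp_rw [mul_sum]
      rw [← h]
      refine sum_congr rfl fun ν _ => ?_
      rw [Polynomial.eval_finsetSum, sum_mul]
      refine sum_congr rfl fun j hj => ?_
      have hjν : j + (ν - j) = ν := by have := mem_range.mp hj; omega
      have hxν : x ^ ν = x ^ j * x ^ (ν - j) := by rw [← pow_add, hjν]
      have hw2 : (-(w / 2)) ^ j = (-(1 / 2)) ^ j * w ^ j := by rw [← mul_pow]; congr 1; ring
      simp only [Polynomial.eval_mul, Polynomial.eval_C, Polynomial.eval_pow, Polynomial.eval_X]
      rw [hxν, hw2]
      ring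
    have hsplit : g * exp (-(w / 2 * y)) - ∑ j ∈ range M, (-(w / 2)) ^ j / (j.factorial : ℝ) *
          x ^ j * ∑ i ∈ range (M - j), q j i * x ^ i
        = g * (exp (-(w / 2 * y)) - ∑ j ∈ range M, (-(w / 2 * y)) ^ j / (j.factorial : ℝ)) +
          ∑ j ∈ range M, (-(w / 2)) ^ j / (j.factorial : ℝ) * x ^ j *
            ((1 - x) ^ (-(b + j)) - ∑ i ∈ range (M - j), q j i * x ^ i) := by
      simp_rw [mul_sub, sum_sub_distrib]
      have : ∑ j ∈ range M, (-(w / 2)) ^ j / (j.factorial : ℝ) * x ^ j * (1 - x) ^ (-(b + j))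
          = g * ∑ j ∈ range M, (-(w / 2 * y)) ^ j / (j.factorial : ℝ) := by
        rw [mul_sum]
        refine sum_congr rfl fun j _ => ?_
        have e1 : (1 - x) ^ (-(b + j)) = g * ((1 - x) ^ j)⁻¹ := by
          rw [neg_add, rpow_add h1x, rpow_neg h1x.le (j : ℝ), rpow_natCast]
        have e2 : (-(w / 2 * y)) ^ j = (-(w / 2)) ^ j * (x ^ j * ((1 - x) ^ j)⁻¹) := by
          rw [← inv_pow, ← mul_pow, ← mul_pow, hy]; congr 1; ring
        rw [e1, e2]; ring
      rw [this]; ring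
    have hfirst : |g * (exp (-(w / 2 * y)) -
        ∑ j ∈ range M, (-(w / 2 * y)) ^ j / (j.factorial : ℝ))|
        ≤ 2 ^ b * A * (x ^ M * (1 + w) ^ M) := by
      rw [abs_mul, abs_of_nonneg hg0, mul_assoc]
      refine mul_le_mul hg2 ((hA _ (by positivity)).trans ?_) (abs_nonneg _) (by positivity)
      rw [← mul_pow]
      refine mul_le_mul_of_nonneg_left (pow_le_pow_left₀ (by positivity) ?_ M) hA0
      nlinarith [mul_le_mul_of_nonneg_left hy2 hw]
    have hterm : ∀ j ∈ range M, |(-(w / 2)) ^ j / (j.factorial : ℝ) * x ^ j *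
            ((1 - x) ^ (-(b + j)) - ∑ i ∈ range (M - j), q j i * x ^ i)|
        ≤ B j * (x ^ M * (1 + w) ^ M) := by
      intro j hj
      have hj := mem_range.mp hj
      have hc : |(-(w / 2)) ^ j / (j.factorial : ℝ)| ≤ (1 + w) ^ M := by
        rw [abs_div, abs_pow, abs_neg, abs_of_nonneg (by positivity : 0 ≤ w / 2), Nat.abs_cast]
        have hf : (1 : ℝ) ≤ j.factorial := by exact_mod_cast j.factorial_pos
        refine (div_le_self (by positivity) hf).trans ?_
        calc (w / 2) ^ j ≤ (1 + w) ^ j := by gcongr; linarith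
          _ ≤ (1 + w) ^ M := pow_le_pow_right₀ (by linarith) hj.le
      have hxM : x ^ M = x ^ j * x ^ (M - j) := by rw [← pow_add]; congr 1; omega
      rw [abs_mul, abs_mul, abs_of_nonneg (by positivity : 0 ≤ x ^ j)]
      calc _ ≤ (1 + w) ^ M * x ^ j * (B j * x ^ (M - j)) := by
            gcongr
            exact hB j hj x hx0 hx
        _ = _ := by rw [hxM]; ring
    rw [hpoly, hsplit]
    calc _ ≤ _ := abs_add_le _ _
      _ ≤ 2 ^ b * A * (x ^ M * (1 + w) ^ M) + ∑ j ∈ range M, B j * (x ^ M * (1 + w) ^ M) :=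
          add_le_add hfirst ((abs_sum_le_sum_abs _ _).trans (sum_le_sum hterm))
      _ = _ := by rw [← sum_mul]; ring

lemma sum_range_rpow_neg_le {r : ℝ} (hr0 : 0 ≤ r) (hr : r < 1) (n : ℕ) :
    ∑ k ∈ range n, ((k : ℝ) + 1) ^ (-r) ≤ (n : ℝ) ^ (1 - r) / (1 - r) := by
  have h1r : 0 < 1 - r := by linarith
  induction n with
  | zero => simp [zero_rpow h1r.ne']
  | succ k ih =>
    rw [sum_range_succ, le_div_iff₀ h1r]
    rw [le_div_iff₀ h1r] at ih
    have hk : (0 : ℝ) < (k : ℝ) + 1 := by positivity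
    have hB := rpow_one_add_le_one_add_mul_self (s := -(1 / ((k : ℝ) + 1))) (p := 1 - r)
      (by
        have : 1 / ((k : ℝ) + 1) ≤ 1 := by
          rw [div_le_one hk]; have := k.cast_nonneg (α := ℝ); linarith
        linarith) h1r.le (by linarith)
    have e1 : 1 + -(1 / ((k : ℝ) + 1)) = k / (k + 1) := by field_simp; ring
    rw [e1, div_rpow (by positivity) hk.le, div_le_iff₀ (by positivity)] at hB
    have e2 : ((k : ℝ) + 1) ^ (-r) * (k + 1) = (k + 1) ^ (1 - r) := by
      rw [← rpow_add_one hk.ne']; congr 1; ring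
    have e3 : (1 + (1 - r) * -(1 / ((k : ℝ) + 1))) * (k + 1) ^ (1 - r)
        = (k + 1) ^ (1 - r) - (1 - r) * (k + 1) ^ (-r) := by
      rw [← e2]; field_simp; ring
    push_cast
    linarith

lemma sum_range_rpow_neg_tail_le {q : ℝ} (hq : 0 < q) {N : ℕ} (hN : 0 < N) (L : ℕ) :
    ∑ i ∈ range L, (((i + (N + 1) : ℕ) : ℝ)) ^ (-(q + 1)) ≤ (N : ℝ) ^ (-q) / q := by
  suffices h : ∑ i ∈ range L, (((i + (N + 1) : ℕ) : ℝ)) ^ (-(q + 1))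
      ≤ ((N : ℝ) ^ (-q) - ((N + L : ℕ) : ℝ) ^ (-q)) / q by
    refine h.trans ?_
    gcongr
    exact sub_le_self _ (by positivity)
  induction L with
  | zero => simp
  | succ L ih =>
    rw [sum_range_succ, le_div_iff₀ hq]
    rw [le_div_iff₀ hq] at ih
    have hk : (0 : ℝ) < ((N + L : ℕ) : ℝ) := by exact_mod_cast (by omega : 0 < N + L)
    set k : ℝ := ((N + L : ℕ) : ℝ)
    have e0 : ((L + (N + 1) : ℕ) : ℝ) = k + 1 := by simp only [k]; push_cast; ring
    have e0' : ((N + (L + 1) : ℕ) : ℝ) = k + 1 := by simp only [k]; push_cast; ring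
    rw [e0, e0']
    have hk1 : 0 < k + 1 := by positivity
    have hratio : 0 < k / (k + 1) := by positivity
    have hlog : log (k / (k + 1)) ≤ -(1 / (k + 1)) := by
      have := log_le_sub_one_of_pos hratio
      have e : k / (k + 1) - 1 = -(1 / (k + 1)) := by field_simp; ring
      linarith
    have hexp : 1 + q * (1 / (k + 1)) ≤ (k / (k + 1)) ^ (-q) := by
      rw [rpow_def_of_pos hratio]
      have := add_one_le_exp (log (k / (k + 1)) * -q)
      nlinarith
    rw [div_rpow hk.le hk1.le, le_div_iff₀ (by positivity)] at hexp
    have e2 : (k + 1) ^ (-(q + 1)) * (k + 1) = (k + 1) ^ (-q) := by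
      rw [← rpow_add_one hk1.ne']; congr 1; ring
    have e3 : (1 + q * (1 / (k + 1))) * (k + 1) ^ (-q)
        = (k + 1) ^ (-q) + q * (k + 1) ^ (-(q + 1)) := by
      rw [← e2]; field_simp
    linarith

lemma one_le_log_of_four_le {n : ℕ} (hn : 4 ≤ n) : 1 ≤ log n := by
  rw [le_log_iff_exp_le (by positivity)]
  have : (4 : ℝ) ≤ n := by exact_mod_cast hn
  linarith [exp_one_lt_d9]

lemma exists_tail_bound {d s : ℝ} (hd : 0 ≤ d) (hs : 1 < s) :
    ∃ C : ℝ, 0 ≤ C ∧ ∀ n : ℕ, 4 ≤ n → ∀ L : ℕ,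
      ∑ i ∈ range L, log ((i + (n / 2 + 1) : ℕ) : ℝ) ^ d * ((i + (n / 2 + 1) : ℕ) : ℝ) ^ (-s)
        ≤ C * (log n ^ d * (n : ℝ) ^ (1 - s)) := by
  set ε := (s - 1) / (2 * (d + 1)) with hε
  have hε0 : 0 < ε := div_pos (by linarith) (by linarith)
  have hεd : ε * d < s - 1 := by
    have : ε * (2 * (d + 1)) = s - 1 := div_mul_cancel₀ _ (by linarith)
    nlinarith
  set q := s - 1 - ε * d with hq
  have hq0 : 0 < q := by linarith
  set A := 2 ^ ε + 1 / ε
  have hA : 0 < A := by positivity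
  refine ⟨A ^ d * (4 ^ q / q), by positivity, fun n hn L => ?_⟩
  have hn0 : (0 : ℝ) < n := by exact_mod_cast (by omega : 0 < n)
  have hlogn := one_le_log_of_four_le hn
  have hterm : ∀ i ∈ range L,
      log ((i + (n / 2 + 1) : ℕ) : ℝ) ^ d * ((i + (n / 2 + 1) : ℕ) : ℝ) ^ (-s)
      ≤ A ^ d * log n ^ d * (n : ℝ) ^ (-(ε * d)) * ((i + (n / 2 + 1) : ℕ) : ℝ) ^ (-(q + 1)) := by
    intro i _
    have hk2 : (n : ℝ) ≤ 2 * ((i + (n / 2 + 1) : ℕ) : ℝ) := by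
      exact_mod_cast (by omega : n ≤ 2 * (i + (n / 2 + 1)))
    have hk1 : (1 : ℝ) ≤ ((i + (n / 2 + 1) : ℕ) : ℝ) := by
      exact_mod_cast (by omega : 1 ≤ i + (n / 2 + 1))
    set k : ℝ := ((i + (n / 2 + 1) : ℕ) : ℝ)
    have hk0 : 0 < k := by linarith
    have hlog : log k ≤ A * log n * (k / n) ^ ε := by
      have h1 : log (k / n) ≤ (k / n) ^ ε / ε := log_le_rpow_div (by positivity) hε0
      have h2 : 1 ≤ 2 ^ ε * (k / n) ^ ε := by
        rw [← mul_rpow (by norm_num) (by positivity)]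
        refine one_le_rpow ?_ hε0.le
        rw [← mul_div_assoc, one_le_div hn0]; exact hk2
      rw [log_div hk0.ne' hn0.ne'] at h1
      have h3 : 0 ≤ (k / n) ^ ε / ε := by positivity
      have h4 : A * log n * (k / n) ^ ε
          = log n * (2 ^ ε * (k / n) ^ ε) + log n * ((k / n) ^ ε / ε) := by
        simp only [A]; ring
      rw [h4]
      nlinarith [mul_le_mul_of_nonneg_right hlogn h3]
    have hlogd : log k ^ d ≤ A ^ d * log n ^ d * (k ^ (ε * d) * (n : ℝ) ^ (-(ε * d))) := by
      refine (rpow_le_rpow (log_nonneg hk1) hlog hd).trans (le_of_eq ?_)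
      rw [mul_rpow (by positivity) (by positivity), mul_rpow (by positivity) (by positivity),
        ← rpow_mul (by positivity), div_rpow hk0.le hn0.le, rpow_neg hn0.le]
      rfl
    calc _ ≤ A ^ d * log n ^ d * (k ^ (ε * d) * (n : ℝ) ^ (-(ε * d))) * k ^ (-s) := by gcongr
      _ = A ^ d * log n ^ d * (n : ℝ) ^ (-(ε * d)) * (k ^ (ε * d) * k ^ (-s)) := by ring
      _ = _ := by rw [← rpow_add hk0]; congr 2; rw [hq]; ring
  have hN : 0 < n / 2 := by omega
  have hhalf : ((n / 2 : ℕ) : ℝ) ^ (-q) ≤ 4 ^ q * (n : ℝ) ^ (-q) := by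
    have h1 : (n : ℝ) / 4 ≤ ((n / 2 : ℕ) : ℝ) := by
      rw [div_le_iff₀ (by norm_num)]
      exact_mod_cast (by omega : n ≤ n / 2 * 4)
    refine (rpow_le_rpow_of_nonpos (by positivity) h1 (by linarith)).trans (le_of_eq ?_)
    rw [div_rpow hn0.le (by norm_num), rpow_neg (by norm_num : (0 : ℝ) ≤ 4), div_inv_eq_mul,
      mul_comm]
  calc _ ≤ _ := sum_le_sum hterm
    _ = A ^ d * log n ^ d * (n : ℝ) ^ (-(ε * d)) *
          ∑ i ∈ range L, ((i + (n / 2 + 1) : ℕ) : ℝ) ^ (-(q + 1)) := by rw [mul_sum]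
    _ ≤ A ^ d * log n ^ d * (n : ℝ) ^ (-(ε * d)) * (4 ^ q * (n : ℝ) ^ (-q) / q) := by
        gcongr
        exact (sum_range_rpow_neg_tail_le hq0 hN L).trans (by gcongr)
    _ = A ^ d * (4 ^ q / q) * (log n ^ d * ((n : ℝ) ^ (-(ε * d)) * (n : ℝ) ^ (-q))) := by ring
    _ = _ := by rw [← rpow_add hn0]; congr 3; rw [hq]; ring

lemma exists_head_bound {r : ℝ} (hr0 : 0 ≤ r) (hr : r ≤ 1) :
    ∃ C : ℝ, 0 ≤ C ∧ ∀ n : ℕ, 4 ≤ n →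
      ∑ k ∈ range n, ((k : ℝ) + 1) ^ (-r)
        ≤ C * (log n ^ (if r = 1 then (1 : ℝ) else 0) * (n : ℝ) ^ (1 - r)) := by
  rcases hr.lt_or_eq with h | rfl
  · refine ⟨1 / (1 - r), by have : 0 < 1 - r := by linarith
                            positivity, fun n _ => ?_⟩
    rw [if_neg h.ne, rpow_zero, one_mul, one_div_mul_eq_div]
    exact sum_range_rpow_neg_le hr0 h n
  · refine ⟨2, by norm_num, fun n hn => ?_⟩
    have h := harmonic_le_one_add_log n
    have hlogn := one_le_log_of_four_le hn
    rw [harmonic] at h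
    push_cast at h
    simp only [rpow_neg_one, if_true, rpow_one, sub_self, rpow_zero, mul_one]
    linarith

lemma exists_gaussian_moment_bound (L : ℕ) :
    ∃ C : ℝ, 0 ≤ C ∧ ∀ w : ℝ, 0 ≤ w → (1 + w) ^ L * exp (-(w / 2)) ≤ C := by
  refine ⟨2 ^ L * L.factorial * exp (1 / 2), by positivity, fun w hw => ?_⟩
  have h := pow_div_factorial_le_exp ((1 + w) / 2) (by positivity) L
  rw [div_le_iff₀ (by positivity), div_pow, div_le_iff₀ (by positivity)] at h
  calc _ ≤ exp ((1 + w) / 2) * L.factorial * 2 ^ L * exp (-(w / 2)) := by gcongr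
    _ = 2 ^ L * L.factorial * (exp ((1 + w) / 2) * exp (-(w / 2))) := by ring
    _ = _ := by rw [← exp_add]; congr 2; ring

section Moments

variable {a d C₀ : ℝ} {v : ℕ → ℝ}

lemma abs_mul_pow_le_of_decay
    (hv : ∀ k : ℕ, 2 ≤ k → |v k| ≤ C₀ * log k ^ d / (k : ℝ) ^ a) (ν : ℕ) {k : ℕ} (hk : 2 ≤ k) :
    |v k| * (k : ℝ) ^ ν ≤ C₀ * (log k ^ d * (k : ℝ) ^ (-(a - ν))) := by
  have hk0 : (0 : ℝ) < k := by exact_mod_cast (by omega : 0 < k)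
  calc |v k| * (k : ℝ) ^ ν ≤ C₀ * log k ^ d / (k : ℝ) ^ a * (k : ℝ) ^ ν := by
        gcongr
        exact hv k hk
    _ = C₀ * (log k ^ d * ((k : ℝ) ^ (-a) * (k : ℝ) ^ (ν : ℝ))) := by
        rw [rpow_neg hk0.le, rpow_natCast]; ring
    _ = _ := by rw [← rpow_add hk0]; congr 3; ring

lemma exists_moment_tail_bound (hd : 0 ≤ d) (hC₀ : 0 < C₀)
    (hv : ∀ k : ℕ, 2 ≤ k → |v k| ≤ C₀ * log k ^ d / (k : ℝ) ^ a) {ν : ℕ} (hν : (ν : ℝ) < a - 1) :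
    ∃ C : ℝ, 0 ≤ C ∧ ∀ n : ℕ, 4 ≤ n →
      |∑ k ∈ Icc 2 (n / 2), v k * (k : ℝ) ^ ν -
          ∑' k : ℕ, if 2 ≤ k then v k * (k : ℝ) ^ ν else 0|
        ≤ C * (log n ^ d * (n : ℝ) ^ (1 - (a - ν))) := by
  obtain ⟨C, hC, h⟩ := exists_tail_bound hd (by linarith : 1 < a - ν)
  set u : ℕ → ℝ := fun k => if 2 ≤ k then v k * (k : ℝ) ^ ν else 0 with hu
  have hpartial : ∀ n : ℕ, 4 ≤ n → ∀ L : ℕ,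
      ∑ i ∈ range L, |u (i + (n / 2 + 1))| ≤ C₀ * (C * (log n ^ d * (n : ℝ) ^ (1 - (a - ν)))) := by
    intro n hn L
    refine le_trans ?_ (mul_le_mul_of_nonneg_left (h n hn L) hC₀.le)
    rw [mul_sum]
    refine sum_le_sum fun i _ => ?_
    have hk : 2 ≤ i + (n / 2 + 1) := by omega
    simp only [hu, if_pos hk, abs_mul, abs_pow, Nat.abs_cast]
    exact abs_mul_pow_le_of_decay hv ν hk
  have hsummable : Summable u := by
    rw [← summable_nat_add_iff (4 / 2 + 1)]
    exact Summable.of_abs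
      (summable_of_sum_range_le (fun _ => abs_nonneg _) (hpartial 4 le_rfl))
  refine ⟨C₀ * C, by positivity, fun n hn => ?_⟩
  have hhead : ∑ k ∈ Icc 2 (n / 2), v k * (k : ℝ) ^ ν = ∑ k ∈ range (n / 2 + 1), u k := by
    have hsub : Icc 2 (n / 2) ⊆ range (n / 2 + 1) := fun k hk => by
      simp only [mem_Icc, mem_range] at *; omega
    rw [← sum_subset hsub]
    · refine sum_congr rfl fun k hk => ?_
      simp only [hu, if_pos (mem_Icc.mp hk).1]
    · intro k hk hk'
      simp only [mem_Icc, mem_range] at *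
      simp only [hu]
      rw [if_neg (by omega)]
  have habs : Summable fun i => |u (i + (n / 2 + 1))| :=
    summable_of_sum_range_le (fun _ => abs_nonneg _) (hpartial n hn)
  rw [hhead, ← hsummable.sum_add_tsum_nat_add (n / 2 + 1), sub_add_cancel_left, abs_neg, mul_assoc]
  have h1 : |∑' i, u (i + (n / 2 + 1))| ≤ ∑' i, |u (i + (n / 2 + 1))| := by
    simpa only [norm_eq_abs] using
      norm_tsum_le_tsum_norm (f := fun i => u (i + (n / 2 + 1))) habs
  exact h1.trans (Real.tsum_le_of_sum_range_le (fun _ => abs_nonneg _) (hpartial n hn))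

lemma exists_moment_head_bound (hd : 0 ≤ d) (hC₀ : 0 < C₀)
    (hv : ∀ k : ℕ, 2 ≤ k → |v k| ≤ C₀ * log k ^ d / (k : ℝ) ^ a) {M : ℕ}
    (hM : (M : ℝ) ≤ a) (hM' : a ≤ M + 1) :
    ∃ C : ℝ, 0 ≤ C ∧ ∀ n : ℕ, 4 ≤ n →
      ∑ k ∈ Icc 2 (n / 2), |v k| * (k : ℝ) ^ M
        ≤ C * (log n ^ (d + if a = M + 1 then (1 : ℝ) else 0) * (n : ℝ) ^ (1 - (a - M))) := by
  obtain ⟨C, hC, h⟩ := exists_head_bound (by linarith : 0 ≤ a - M) (by linarith)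
  refine ⟨C₀ * C, by positivity, fun n hn => ?_⟩
  have hlogn := one_le_log_of_four_le hn
  have hiff : a - M = 1 ↔ a = M + 1 := by constructor <;> intro h <;> linarith
  have hn' := h n hn
  simp only [hiff] at hn'
  have hsum : ∑ k ∈ Icc 2 (n / 2), (k : ℝ) ^ (-(a - M))
      ≤ ∑ k ∈ range n, ((k : ℝ) + 1) ^ (-(a - M)) := by
    have e : ∑ k ∈ range n, ((k : ℝ) + 1) ^ (-(a - M))
        = ∑ k ∈ Ico 1 (n + 1), (k : ℝ) ^ (-(a - M)) := by
      rw [sum_Ico_eq_sum_range]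
      refine sum_congr (by simp) fun k _ => ?_
      push_cast
      rw [add_comm]
    rw [e]
    refine sum_le_sum_of_subset_of_nonneg (fun k hk => ?_) fun _ _ _ => by positivity
    simp only [mem_Icc, mem_Ico] at *
    omega
  calc _ ≤ ∑ k ∈ Icc 2 (n / 2), C₀ * (log n ^ d * (k : ℝ) ^ (-(a - M))) := by
        refine sum_le_sum fun k hk => ?_
        have hk := mem_Icc.mp hk
        refine (abs_mul_pow_le_of_decay hv M hk.1).trans ?_
        have hk1 : (1 : ℝ) ≤ k := by exact_mod_cast (by omega : 1 ≤ k)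
        have hkn : (k : ℝ) ≤ n := by exact_mod_cast (by omega : k ≤ n)
        have := log_nonneg hk1
        gcongr
    _ = C₀ * (log n ^ d * ∑ k ∈ Icc 2 (n / 2), (k : ℝ) ^ (-(a - M))) := by
        rw [mul_sum, mul_sum]
    _ ≤ C₀ * (log n ^ d * (C * (log n ^ (if a = M + 1 then (1 : ℝ) else 0) *
          (n : ℝ) ^ (1 - (a - M))))) := by
        gcongr
        exact hsum.trans hn'
    _ = _ := by rw [rpow_add (by linarith)]; ring

/-- The expansion after factoring out `z ^ m * n ^ (-b) * exp (-w / 2)`, where `w = z ^ 2 / n`. -/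
lemma exists_kernel_sum_bound {b : ℝ} (hb : 0 < b) (hd : 0 ≤ d) (hC₀ : 0 < C₀)
    (hv : ∀ k : ℕ, 2 ≤ k → |v k| ≤ C₀ * log k ^ d / (k : ℝ) ^ a) {M : ℕ}
    (hM : (M : ℝ) < a) (hM' : a ≤ M + 1) :
    ∃ (K : ℕ → Polynomial ℝ) (C : ℝ), 0 ≤ C ∧ (∀ ν, (K ν).natDegree ≤ ν) ∧
      ∀ n : ℕ, 4 ≤ n → ∀ w : ℝ, 0 ≤ w →
        |∑ k ∈ Icc 2 (n / 2), v k *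
            ((1 - (k : ℝ) / n) ^ (-b) * exp (-(w / 2 * ((k : ℝ) / n / (1 - (k : ℝ) / n))))) -
          ∑ ν ∈ range M, (K ν).eval w * ((n : ℝ) ^ ν)⁻¹|
        ≤ C * (log n ^ (d + if a = M + 1 then (1 : ℝ) else 0) * (n : ℝ) ^ (1 - a)) *
            (1 + w) ^ M := by
  obtain ⟨P, A, hA, hdeg, hP⟩ := exists_kernel_taylor_bound hb M
  obtain ⟨H, hH0, hH⟩ := exists_moment_head_bound hd hC₀ hv hM.le hM'
  have htail : ∀ ν : ℕ, ∃ C : ℝ, 0 ≤ C ∧ (ν < M → ∀ n : ℕ, 4 ≤ n →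
      |∑ k ∈ Icc 2 (n / 2), v k * (k : ℝ) ^ ν -
          ∑' k : ℕ, if 2 ≤ k then v k * (k : ℝ) ^ ν else 0|
        ≤ C * (log n ^ d * (n : ℝ) ^ (1 - (a - ν)))) := by
    intro ν
    by_cases hν : ν < M
    · have : (ν : ℝ) + 1 ≤ M := by exact_mod_cast hν
      obtain ⟨C, hC, h⟩ := exists_moment_tail_bound hd hC₀ hv (by linarith : (ν : ℝ) < a - 1)
      exact ⟨C, hC, fun _ => h⟩
    · exact ⟨0, le_rfl, fun h => absurd h hν⟩
  choose T hT0 hT using htail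
  choose E hE0 hE using fun ν => exists_polynomial_eval_bound (P ν) (hdeg ν)
  set S : ℕ → ℝ := fun ν => ∑' k : ℕ, if 2 ≤ k then v k * (k : ℝ) ^ ν else 0
  refine ⟨fun ν => Polynomial.C (S ν) * P ν, A * H + ∑ ν ∈ range M, E ν * T ν, ?_,
    fun ν => (Polynomial.natDegree_C_mul_le _ _).trans (hdeg ν), fun n hn w hw => ?_⟩
  · have := sum_nonneg fun ν (_ : ν ∈ range M) => mul_nonneg (hE0 ν) (hT0 ν)
    positivity
  have hn0 : (0 : ℝ) < n := by exact_mod_cast (by omega : 0 < n)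
  have hlogn := one_le_log_of_four_le hn
  set δ : ℝ := if a = M + 1 then (1 : ℝ) else 0 with hδ
  have hδ0 : 0 ≤ δ := by rw [hδ]; split_ifs <;> norm_num
  set F : ℕ → ℝ := fun k =>
    (1 - (k : ℝ) / n) ^ (-b) * exp (-(w / 2 * ((k : ℝ) / n / (1 - (k : ℝ) / n))))
  set B := log n ^ (d + δ) * (n : ℝ) ^ (1 - a)
  have hB0 : 0 ≤ B := by positivity
  have hsplit : ∑ k ∈ Icc 2 (n / 2), v k * F k -
        ∑ ν ∈ range M, (Polynomial.C (S ν) * P ν).eval w * ((n : ℝ) ^ ν)⁻¹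
      = ∑ k ∈ Icc 2 (n / 2), v k * (F k - ∑ ν ∈ range M, (P ν).eval w * ((k : ℝ) / n) ^ ν) +
        ∑ ν ∈ range M, (P ν).eval w * ((n : ℝ) ^ ν)⁻¹ *
          (∑ k ∈ Icc 2 (n / 2), v k * (k : ℝ) ^ ν - S ν) := by
    have hswap : ∑ k ∈ Icc 2 (n / 2), v k * ∑ ν ∈ range M, (P ν).eval w * ((k : ℝ) / n) ^ ν
        = ∑ ν ∈ range M, (P ν).eval w * ((n : ℝ) ^ ν)⁻¹ *
          ∑ k ∈ Icc 2 (n / 2), v k * (k : ℝ) ^ ν := by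
      simp_rw [mul_sum]
      rw [sum_comm]
      refine sum_congr rfl fun ν _ => sum_congr rfl fun k _ => ?_
      rw [div_pow]; ring
    simp_rw [mul_sub, sum_sub_distrib]
    rw [hswap, sub_add_sub_cancel]
    congr 1
    refine sum_congr rfl fun ν _ => ?_
    rw [Polynomial.eval_mul, Polynomial.eval_C]; ring
  have hhead : |∑ k ∈ Icc 2 (n / 2),
      v k * (F k - ∑ ν ∈ range M, (P ν).eval w * ((k : ℝ) / n) ^ ν)| ≤ A * H * B * (1 + w) ^ M := by
    calc _ ≤ ∑ k ∈ Icc 2 (n / 2), |v k| * (A * ((k : ℝ) / n) ^ M * (1 + w) ^ M) := by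
          refine (abs_sum_le_sum_abs _ _).trans (sum_le_sum fun k hk => ?_)
          have hk := mem_Icc.mp hk
          rw [abs_mul]
          gcongr
          refine hP _ w (by positivity) ?_ hw
          rw [div_le_div_iff₀ hn0 (by norm_num)]
          exact_mod_cast (by omega : k * 2 ≤ 1 * n)
      _ = A * (1 + w) ^ M * ((n : ℝ) ^ M)⁻¹ * ∑ k ∈ Icc 2 (n / 2), |v k| * (k : ℝ) ^ M := by
          rw [mul_sum]
          refine sum_congr rfl fun k _ => ?_
          rw [div_pow]; ring
      _ ≤ A * (1 + w) ^ M * ((n : ℝ) ^ M)⁻¹ *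
            (H * (log n ^ (d + δ) * (n : ℝ) ^ (1 - (a - M)))) := by
          gcongr
          exact hH n hn
      _ = A * (1 + w) ^ M * H * log n ^ (d + δ) *
            ((n : ℝ) ^ (-(M : ℝ)) * (n : ℝ) ^ (1 - (a - M))) := by
          rw [rpow_neg hn0.le, rpow_natCast]; ring
      _ = _ := by
          rw [← rpow_add hn0, show -(M : ℝ) + (1 - (a - M)) = 1 - a by ring]
          simp only [B]; ring
  have htail : ∀ ν ∈ range M, |(P ν).eval w * ((n : ℝ) ^ ν)⁻¹ *
      (∑ k ∈ Icc 2 (n / 2), v k * (k : ℝ) ^ ν - S ν)| ≤ E ν * T ν * B * (1 + w) ^ M := by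
    intro ν hν
    have hν := mem_range.mp hν
    have hEν := hE0 ν
    have hTν := hT0 ν
    have hEval : |(P ν).eval w| ≤ E ν * (1 + w) ^ M :=
      (hE ν w hw).trans
        (mul_le_mul_of_nonneg_left (pow_le_pow_right₀ (by linarith) hν.le) hEν)
    rw [abs_mul, abs_mul, abs_of_nonneg (by positivity : 0 ≤ ((n : ℝ) ^ ν)⁻¹)]
    calc _ ≤ E ν * (1 + w) ^ M * ((n : ℝ) ^ ν)⁻¹ *
            (T ν * (log n ^ d * (n : ℝ) ^ (1 - (a - ν)))) := by
          gcongr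
          exact hT ν hν n hn
      _ = E ν * (1 + w) ^ M * T ν * (log n ^ d *
            ((n : ℝ) ^ (-(ν : ℝ)) * (n : ℝ) ^ (1 - (a - ν)))) := by
          rw [rpow_neg hn0.le, rpow_natCast]; ring
      _ = E ν * (1 + w) ^ M * T ν * (log n ^ d * (n : ℝ) ^ (1 - a)) := by
          rw [← rpow_add hn0, show -(ν : ℝ) + (1 - (a - ν)) = 1 - a by ring]
      _ ≤ E ν * (1 + w) ^ M * T ν * B := by
          have : log n ^ d ≤ log n ^ (d + δ) := rpow_le_rpow_of_exponent_le hlogn (by linarith)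
          simp only [B]
          gcongr
      _ = _ := by ring
  rw [hsplit]
  calc _ ≤ _ := abs_add_le _ _
    _ ≤ A * H * B * (1 + w) ^ M + ∑ ν ∈ range M, E ν * T ν * B * (1 + w) ^ M :=
        add_le_add hhead ((abs_sum_le_sum_abs _ _).trans (sum_le_sum htail))
    _ = _ := by rw [← sum_mul, ← sum_mul]; ring

end Moments

/-- Lemma 2: asymptotic expansion for `Σ_{k=2}^{⌊n/2⌋} z^m v_k (n−k)^{−b} e^{−z²/(2(n−k))}`. -/
theorem stmt_7 (a b d : ℝ) (ha : 1 < a) (hb : 0 < b) (hd : 0 ≤ d)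
    (m : ℕ) (v : ℕ → ℝ) (C₀ : ℝ) (hC₀ : 0 < C₀)
    (hv : ∀ k : ℕ, 2 ≤ k → |v k| ≤ C₀ * Real.log k ^ d / (k : ℝ) ^ a) :
    ∃ (K : ℕ → Polynomial ℝ) (C₁ : ℝ), 0 < C₁ ∧
      (∀ ν, ν < ⌊a⌋₊ → (K ν).natDegree ≤ ν) ∧
      ∀ n : ℕ, 4 ≤ n → ∀ z : ℝ,
        |(∑ k ∈ Finset.Icc 2 (n / 2),
            z ^ m * v k * ((n : ℝ) - k) ^ (-b) *
              Real.exp (-z ^ 2 / (2 * ((n : ℝ) - k))))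
          - z ^ m / (n : ℝ) ^ b * Real.exp (-z ^ 2 / (2 * n)) *
              ∑ ν ∈ Finset.range ⌊a⌋₊, (K ν).eval (z ^ 2 / n) * ((n : ℝ) ^ ν)⁻¹|
        ≤ C₁ * Real.log n ^ (d + if ∃ k : ℤ, (k : ℝ) = a then (1 : ℝ) else 0) /
            (n : ℝ) ^ (a + b - (m : ℝ) / 2 - 1) := by
  set M := ⌈a⌉₊ - 1
  have hceil : M + 1 = ⌈a⌉₊ := by
    have : 0 < ⌈a⌉₊ := Nat.ceil_pos.mpr (by linarith)
    omega
  have hM : (M : ℝ) < a := Nat.lt_ceil.mp (by omega)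
  have hM' : a ≤ M + 1 := by
    have := Nat.le_ceil a
    rw [← hceil] at this
    exact_mod_cast this
  have hMfloor : M ≤ ⌊a⌋₊ := Nat.le_floor hM.le
  have hinteger : (∃ k : ℤ, (k : ℝ) = a) ↔ a = M + 1 := by
    constructor
    · rintro ⟨k, rfl⟩
      have h1 : (M : ℤ) < k := by exact_mod_cast hM
      have h2 : k ≤ M + 1 := by exact_mod_cast hM'
      exact_mod_cast (by omega : k = M + 1)
    · intro h
      exact ⟨M + 1, by rw [h]; push_cast; rfl⟩
  obtain ⟨K, C, hC0, hdeg, hK⟩ := exists_kernel_sum_bound hb hd hC₀ hv hM hM'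
  obtain ⟨G, hG0, hG⟩ := exists_gaussian_moment_bound (m + M)
  refine ⟨fun ν => if ν < M then K ν else 0, C * G + 1, by positivity, fun ν _ => ?_,
    fun n hn z => ?_⟩
  · dsimp only
    split_ifs
    · exact hdeg ν
    · simp
  simp only [hinteger]
  have hn0 : (0 : ℝ) < n := by exact_mod_cast (by omega : 0 < n)
  have hlogn := one_le_log_of_four_le hn
  have hKsum : ∑ ν ∈ Finset.range ⌊a⌋₊,
      (if ν < M then K ν else 0).eval (z ^ 2 / n) * ((n : ℝ) ^ ν)⁻¹
      = ∑ ν ∈ Finset.range M, (K ν).eval (z ^ 2 / n) * ((n : ℝ) ^ ν)⁻¹ := by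
    rw [← sum_subset (range_subset_range.mpr hMfloor)]
    · refine sum_congr rfl fun ν hν => ?_
      rw [if_pos (mem_range.mp hν)]
    · intro ν _ hν
      rw [if_neg (by simpa using hν)]
      simp
  set w := z ^ 2 / n with hw
  have hw0 : 0 ≤ w := by positivity
  have hbound := hK n hn w hw0
  set δ : ℝ := if a = M + 1 then (1 : ℝ) else 0
  set X := ∑ k ∈ Icc 2 (n / 2), v k *
    ((1 - (k : ℝ) / n) ^ (-b) * exp (-(w / 2 * ((k : ℝ) / n / (1 - (k : ℝ) / n)))))
  set Y := ∑ ν ∈ Finset.range M, (K ν).eval w * ((n : ℝ) ^ ν)⁻¹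
  have hmain : ∑ k ∈ Finset.Icc 2 (n / 2), z ^ m * v k * ((n : ℝ) - k) ^ (-b) *
      exp (-z ^ 2 / (2 * ((n : ℝ) - k))) = z ^ m * (n : ℝ) ^ (-b) * exp (-(w / 2)) * X := by
    rw [mul_sum]
    refine sum_congr rfl fun k hk => ?_
    have hk := mem_Icc.mp hk
    have hkn : (k : ℝ) < n := by exact_mod_cast (by omega : k < n)
    have hnk : (n : ℝ) - k ≠ 0 := by linarith
    have hnk' : 1 - (k : ℝ) / n ≠ 0 := by
      rw [one_sub_div hn0.ne']; exact div_ne_zero hnk hn0.ne'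
    have h1x : 0 ≤ 1 - (k : ℝ) / n := sub_nonneg.mpr ((div_le_one hn0).mpr hkn.le)
    have e1 : ((n : ℝ) - k) ^ (-b) = (n : ℝ) ^ (-b) * (1 - (k : ℝ) / n) ^ (-b) := by
      rw [← mul_rpow hn0.le h1x]; congr 1; field_simp
    have e2 : -z ^ 2 / (2 * ((n : ℝ) - k))
        = -(w / 2) + -(w / 2 * ((k : ℝ) / n / (1 - (k : ℝ) / n))) := by
      rw [hw, one_sub_div hn0.ne']
      field_simp
      ring
    rw [e1, e2, exp_add]
    ring
  have hfactor : z ^ m / (n : ℝ) ^ b * exp (-z ^ 2 / (2 * n))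
      = z ^ m * (n : ℝ) ^ (-b) * exp (-(w / 2)) := by
    rw [rpow_neg hn0.le, show -z ^ 2 / (2 * (n : ℝ)) = -(w / 2) by rw [hw]; field_simp]
    ring
  have hz : |z| ^ m ≤ (n : ℝ) ^ ((m : ℝ) / 2) * (1 + w) ^ m := by
    have h1 : |z| ≤ √n * (1 + w) := by
      have h2 : z ^ 2 = w * n := by rw [hw]; field_simp
      rw [← sqrt_sq_eq_abs, h2, mul_comm, sqrt_mul hn0.le]
      gcongr
      rw [sqrt_le_left (by linarith)]
      nlinarith
    calc |z| ^ m ≤ (√n * (1 + w)) ^ m := by gcongr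
      _ = _ := by
        rw [mul_pow, sqrt_eq_rpow, ← rpow_natCast ((n : ℝ) ^ (1 / 2 : ℝ)), ← rpow_mul hn0.le]
        congr 2; ring
  rw [hKsum, hmain, hfactor, ← mul_sub, abs_mul, abs_mul, abs_mul, abs_pow,
    abs_of_pos (exp_pos _), abs_of_pos (rpow_pos_of_pos hn0 _)]
  calc _ ≤ (n : ℝ) ^ ((m : ℝ) / 2) * (1 + w) ^ m * (n : ℝ) ^ (-b) * exp (-(w / 2)) *
        (C * (log n ^ (d + δ) * (n : ℝ) ^ (1 - a)) * (1 + w) ^ M) := by gcongr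
    _ = C * ((1 + w) ^ (m + M) * exp (-(w / 2))) * log n ^ (d + δ) *
        ((n : ℝ) ^ ((m : ℝ) / 2) * (n : ℝ) ^ (-b) * (n : ℝ) ^ (1 - a)) := by
        rw [pow_add]; ring
    _ ≤ (C * G + 1) * log n ^ (d + δ) *
        ((n : ℝ) ^ ((m : ℝ) / 2) * (n : ℝ) ^ (-b) * (n : ℝ) ^ (1 - a)) := by
        gcongr
        exact (mul_le_mul_of_nonneg_left (hG w hw0) hC0).trans (by linarith)
    _ = _ := by
        rw [← rpow_add hn0, ← rpow_add hn0, div_eq_mul_inv (_ * _),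
          ← rpow_neg hn0.le]
        congr 2; ring
end

section
/- Let a, b > 0 be reals with a not an integer, and let m ≥ 0 be an integer. Then there exist real numbers c_{i,ν} (for 0 ≤ ν ≤ i ≤ ⌊a⌋−1) and a constant C > 0 such that for all integers n ≥ 4, all t ∈ (0,1), and all reals z, |Σ_{k=2}^{⌊n/2⌋} z^m · (n−k+t)^{−b} · (k−t)^{−a} · e^{−z²/(2(n−k+t))} − (z^m/n^b) · e^{−z²/(2n)} · Σ_{ν=0}^{⌊a⌋−1} (z^{2ν}/n^ν) · Σ_{i=ν}^{⌊a⌋−1} c_{i,ν} · g_{a−i}(t) · n^{−i}| ≤ C / n^{a+b−m/2−1}, where g_λ(t) := Σ_{k=2}^{∞} (k−t)^{−λ}. -/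
open Finset Real

/-- Partial sums of `(v + 1 + j) ^ (-l)` for `0 < l < 1`. -/
lemma sum_rpow_neg_le_of_lt_one {l v : ℝ} (hl0 : 0 < l) (hl1 : l < 1) (hv : 0 ≤ v) (J : ℕ) :
    ∑ j ∈ range J, (v + 1 + j) ^ (-l) ≤ (1 - l)⁻¹ * (v + J) ^ (1 - l) := by
  have hp : 0 < 1 - l := by linarith
  induction J with
  | zero => simpa using by positivity
  | succ J ih =>
    rw [sum_range_succ]
    set u : ℝ := v + J with hu
    have hu0 : 0 ≤ u := by positivity
    have h1 : v + 1 + (J : ℝ) = u + 1 := by rw [hu]; ring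
    have h2 : v + ((J + 1 : ℕ) : ℝ) = u + 1 := by rw [hu]; push_cast; ring
    rw [h1, h2]
    have hB := rpow_one_add_le_one_add_mul_self (s := -(1 / (u + 1)))
      (by rw [neg_le_neg_iff, div_le_one (by positivity)]; linarith) hp.le (by linarith : 1 - l ≤ 1)
    have hsplit : u ^ (1 - l) = (u + 1) ^ (1 - l) * (1 + -(1 / (u + 1))) ^ (1 - l) := by
      rw [← mul_rpow (by positivity)]
      · congr 1; field_simp; ring
      · have : 1 / (u + 1) ≤ 1 := by rw [div_le_one (by positivity)]; linarith
        linarith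
    have hneg : (u + 1) ^ (-l) = (u + 1) ^ (1 - l) / (u + 1) := by
      rw [← rpow_sub_one (by positivity)]; congr 1; ring
    have hpos : 0 < (u + 1) ^ (1 - l) := by positivity
    have key : u ^ (1 - l) + (1 - l) * (u + 1) ^ (-l) ≤ (u + 1) ^ (1 - l) := by
      rw [hsplit, hneg]
      have := mul_le_mul_of_nonneg_left hB hpos.le
      calc _ ≤ (u + 1) ^ (1 - l) * (1 + (1 - l) * -(1 / (u + 1)))
            + (1 - l) * ((u + 1) ^ (1 - l) / (u + 1)) := by gcongr
        _ = _ := by field_simp; ring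
    calc _ ≤ (1 - l)⁻¹ * u ^ (1 - l) + (u + 1) ^ (-l) := by gcongr
      _ = (1 - l)⁻¹ * (u ^ (1 - l) + (1 - l) * (u + 1) ^ (-l)) := by field_simp
      _ ≤ _ := by gcongr

/-- Partial sums of `(v + 1 + j) ^ (-l)` for `1 < l`. -/
lemma sum_rpow_neg_le_of_one_lt {l v : ℝ} (hl : 1 < l) (hv : 0 < v) (J : ℕ) :
    ∑ j ∈ range J, (v + 1 + j) ^ (-l) ≤ (l - 1)⁻¹ * v ^ (1 - l) := by
  have hq : 0 < l - 1 := by linarith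
  suffices h : ∑ j ∈ range J, (v + 1 + j) ^ (-l)
      ≤ (l - 1)⁻¹ * (v ^ (1 - l) - (v + J) ^ (1 - l)) by
    refine h.trans ?_
    gcongr
    have : 0 ≤ (v + J) ^ (1 - l) := by positivity
    linarith
  induction J with
  | zero => simp
  | succ J ih =>
    rw [sum_range_succ]
    set u : ℝ := v + J with hu
    have hu0 : 0 < u := by positivity
    have h1 : v + 1 + (J : ℝ) = u + 1 := by rw [hu]; ring
    have h2 : v + ((J + 1 : ℕ) : ℝ) = u + 1 := by rw [hu]; push_cast; ring
    rw [h1, h2]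
    have hB : 1 + (l - 1) / (u + 1) ≤ (u / (u + 1)) ^ (1 - l) := by
      rw [rpow_def_of_pos (by positivity)]
      have hlog := log_le_sub_one_of_pos (show 0 < u / (u + 1) by positivity)
      have : u / (u + 1) - 1 = -(1 / (u + 1)) := by field_simp; ring
      rw [this] at hlog
      have hexp := add_one_le_exp (log (u / (u + 1)) * (1 - l))
      have : (l - 1) / (u + 1) = (l - 1) * (1 / (u + 1)) := by ring
      nlinarith
    have hsplit : u ^ (1 - l) = (u + 1) ^ (1 - l) * (u / (u + 1)) ^ (1 - l) := by
      rw [← mul_rpow (by positivity) (by positivity)]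
      congr 1; field_simp
    have hneg : (u + 1) ^ (-l) = (u + 1) ^ (1 - l) / (u + 1) := by
      rw [← rpow_sub_one (by positivity)]; congr 1; ring
    have hpos : 0 < (u + 1) ^ (1 - l) := by positivity
    have key : (u + 1) ^ (1 - l) + (l - 1) * (u + 1) ^ (-l) ≤ u ^ (1 - l) := by
      rw [hsplit, hneg]
      calc _ = (u + 1) ^ (1 - l) * (1 + (l - 1) / (u + 1)) := by ring
        _ ≤ _ := by gcongr
    calc _ ≤ (l - 1)⁻¹ * (v ^ (1 - l) - u ^ (1 - l)) + (u + 1) ^ (-l) := by gcongr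
      _ = (l - 1)⁻¹ * (v ^ (1 - l) - (u ^ (1 - l) - (l - 1) * (u + 1) ^ (-l))) := by
        field_simp; ring
      _ ≤ _ := by gcongr; linarith

lemma summable_rpow_neg_of_one_lt {l v : ℝ} (hl : 1 < l) (hv : 0 < v) :
    Summable fun j : ℕ ↦ (v + 1 + j) ^ (-l) :=
  summable_of_sum_range_le (fun _ ↦ by positivity) (sum_rpow_neg_le_of_one_lt hl hv)

lemma tsum_rpow_neg_le_of_one_lt {l v : ℝ} (hl : 1 < l) (hv : 0 < v) :
    ∑' j : ℕ, (v + 1 + j) ^ (-l) ≤ (l - 1)⁻¹ * v ^ (1 - l) :=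
  Real.tsum_le_of_sum_range_le (fun _ ↦ by positivity) (sum_rpow_neg_le_of_one_lt hl hv)

/-- Taylor bound for `exp (-y)` valid for all `y ≥ 0`. -/
lemma exists_abs_exp_neg_sub_sum_le (N : ℕ) :
    ∃ K : ℝ, 0 ≤ K ∧ ∀ y : ℝ, 0 ≤ y →
      |exp (-y) - ∑ j ∈ range N, (-y) ^ j / j.factorial| ≤ K * y ^ N := by
  rcases N.eq_zero_or_pos with rfl | hN
  · exact ⟨1, zero_le_one, fun y hy ↦ by simpa using hy⟩
  refine ⟨((N.succ : ℝ) / (N.factorial * N)) + (1 + N), by positivity, fun y hy ↦ ?_⟩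
  rcases le_total y 1 with h1 | h1
  · have := Real.exp_bound (x := -y) (by rwa [abs_neg, abs_of_nonneg hy]) hN
    rw [abs_neg, abs_of_nonneg hy] at this
    refine this.trans ?_
    rw [mul_comm]
    gcongr
    linarith [(Nat.cast_nonneg N : (0 : ℝ) ≤ N)]
  · have hpow : ∀ j ∈ range N, |(-y) ^ j / (j.factorial : ℝ)| ≤ y ^ N := fun j hj ↦ by
      rw [abs_div, abs_pow, abs_neg, abs_of_nonneg hy, Nat.abs_cast]
      calc y ^ j / (j.factorial : ℝ) ≤ y ^ j :=
            div_le_self (by positivity) (mod_cast j.factorial_pos)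
        _ ≤ y ^ N := pow_le_pow_right₀ h1 (mem_range.1 hj).le
    have hsum : |∑ j ∈ range N, (-y) ^ j / (j.factorial : ℝ)| ≤ N * y ^ N := by
      refine (abs_sum_le_sum_abs _ _).trans ((sum_le_sum hpow).trans ?_)
      simp
    have hexp : |exp (-y)| ≤ y ^ N := by
      rw [abs_of_pos (exp_pos _)]
      exact (exp_le_one_iff.2 (by linarith)).trans (one_le_pow₀ h1)
    have hK : (0 : ℝ) ≤ (N.succ : ℝ) / (N.factorial * N) * y ^ N := by positivity
    calc _ ≤ |exp (-y)| + |∑ j ∈ range N, (-y) ^ j / (j.factorial : ℝ)| := abs_sub _ _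
      _ ≤ y ^ N + N * y ^ N := add_le_add hexp hsum
      _ ≤ _ := by linarith

/-- Taylor expansion of `(1 - x) ^ (-β)` at `0`, uniformly on `[0, 1/2]`. -/
lemma exists_abs_one_sub_rpow_sub_sum_le (β : ℝ) :
    ∃ d : ℕ → ℝ, ∀ M : ℕ, ∃ D : ℝ, 0 ≤ D ∧ ∀ x ∈ Set.Icc (0 : ℝ) (1 / 2),
      |(1 - x) ^ (-β) - ∑ l ∈ range M, d l * x ^ l| ≤ D * x ^ M := by
  set f : ℝ → ℝ := fun x ↦ (1 - x) ^ (-β) with hf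
  have hne : ∀ x ∈ Set.Icc (0 : ℝ) (1 / 2), 1 - x ≠ 0 := fun x hx ↦ by
    have := hx.2; intro h; linarith
  have hcd : ∀ n : WithTop ℕ∞, ContDiffOn ℝ n f (Set.Icc 0 (1 / 2)) := fun n ↦
    (contDiffOn_const.sub contDiffOn_id).rpow_const_of_ne hne
  refine ⟨fun l ↦ (l.factorial : ℝ)⁻¹ * iteratedDerivWithin l f (Set.Icc 0 (1 / 2)) 0, fun M ↦ ?_⟩
  rcases M with _ | M
  · obtain ⟨D, hD⟩ := isCompact_Icc.exists_bound_of_continuousOn (hcd 0).continuousOn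
    refine ⟨|D|, abs_nonneg D, fun x hx ↦ ?_⟩
    simpa using (hD x hx).trans (le_abs_self D)
  · obtain ⟨D, hD⟩ := exists_taylor_mean_remainder_bound (n := M) (by norm_num : (0 : ℝ) ≤ 1 / 2)
      (hcd (M + 1))
    refine ⟨|D|, abs_nonneg D, fun x hx ↦ ?_⟩
    have h := hD x hx
    rw [taylor_within_apply, norm_eq_abs, sub_zero] at h
    calc _ = |f x - ∑ k ∈ range (M + 1),
          ((k.factorial : ℝ)⁻¹ * x ^ k) • iteratedDerivWithin k f (Set.Icc 0 (1 / 2)) 0| := by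
          congr 2
          exact sum_congr rfl fun k _ ↦ by rw [smul_eq_mul]; ring
      _ ≤ D * x ^ (M + 1) := h
      _ ≤ _ := mul_le_mul_of_nonneg_right (le_abs_self D) (pow_nonneg hx.1 _)

/-- The Gaussian weight dominates every power. -/
lemma exists_abs_pow_mul_exp_le (p : ℕ) :
    ∃ B : ℝ, 0 ≤ B ∧ ∀ s : ℝ, |s| ^ p * exp (-(s ^ 2 / 2)) ≤ B := by
  refine ⟨1 + 2 ^ p * p.factorial, by positivity, fun s ↦ ?_⟩
  have h1 : |s| ^ p ≤ 1 + (s ^ 2) ^ p := by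
    have : (s ^ 2) ^ p = (|s| ^ p) ^ 2 := by rw [← sq_abs]; ring
    rw [this]
    nlinarith [sq_nonneg (|s| ^ p - 1), pow_nonneg (abs_nonneg s) p]
  have h2 := pow_div_factorial_le_exp (s ^ 2 / 2) (by positivity) p
  rw [div_le_iff₀ (by positivity), div_pow, div_le_iff₀ (by positivity)] at h2
  have h3 : 1 ≤ exp (s ^ 2 / 2) := one_le_exp (by positivity)
  rw [exp_neg, ← div_eq_mul_inv, div_le_iff₀ (exp_pos _)]
  linarith

/-- Expansion in powers of `x` of the summand after rescaling, uniformly against the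
Gaussian weight. -/
lemma exists_weighted_expansion {b : ℝ} (hb : 0 < b) (m N : ℕ) :
    ∃ (c : ℕ → ℕ → ℝ) (C : ℝ), 0 ≤ C ∧ ∀ x ∈ Set.Icc (0 : ℝ) (1 / 2), ∀ s : ℝ,
      |s| ^ m * exp (-(s ^ 2 / 2)) *
        |(1 - x) ^ (-b) * exp (-(s ^ 2 / 2 * (x / (1 - x))))
          - ∑ ν ∈ range N, s ^ (2 * ν) * ∑ i ∈ Icc ν (N - 1), c i ν * x ^ i| ≤ C * x ^ N := by
  choose d hd using fun ν : ℕ ↦ exists_abs_one_sub_rpow_sub_sum_le (b + ν)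
  choose D hD0 hD using hd
  obtain ⟨K, hK0, hK⟩ := exists_abs_exp_neg_sub_sum_le N
  choose B hB0 hB using exists_abs_pow_mul_exp_le
  refine ⟨fun i ν ↦ (-1 / 2) ^ ν / ν.factorial * d ν (i - ν),
    2 ^ b * K * B (m + 2 * N) + ∑ ν ∈ range N, D ν (N - ν) * B (m + 2 * ν),
    add_nonneg (mul_nonneg (by positivity) (hB0 _))
      (sum_nonneg fun ν _ ↦ mul_nonneg (hD0 _ _) (hB0 _)), fun x hx s ↦ ?_⟩
  obtain ⟨hx0, hx1⟩ := hx
  have h1x : 0 < 1 - x := by linarith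
  set y : ℝ := s ^ 2 / 2 * (x / (1 - x)) with hy
  have hy0 : 0 ≤ y := by positivity
  have hyle : y ≤ s ^ 2 * x := by
    have : x / (1 - x) ≤ 2 * x := by rw [div_le_iff₀ h1x]; nlinarith
    calc y ≤ s ^ 2 / 2 * (2 * x) := by rw [hy]; gcongr
      _ = _ := by ring
  have hcoef : ∀ ν ∈ range N,
      s ^ (2 * ν) * ∑ i ∈ Icc ν (N - 1), (-1 / 2) ^ ν / ν.factorial * d ν (i - ν) * x ^ i
        = (-1 / 2) ^ ν / ν.factorial * s ^ (2 * ν) * x ^ ν *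
            ∑ l ∈ range (N - ν), d ν l * x ^ l := fun ν hν ↦ by
    have hν := mem_range.1 hν
    have hIcc : Icc ν (N - 1) = Ico ν N := by ext i; simp only [mem_Icc, mem_Ico]; omega
    rw [hIcc, sum_Ico_eq_sum_range, mul_sum, mul_sum]
    refine sum_congr rfl fun l _ ↦ ?_
    rw [Nat.add_sub_cancel_left, pow_add]
    ring
  have hexpand : ∀ ν ∈ range N, (1 - x) ^ (-b) * ((-y) ^ ν / ν.factorial)
      = (-1 / 2) ^ ν / ν.factorial * s ^ (2 * ν) * x ^ ν * (1 - x) ^ (-(b + ν)) := fun ν _ ↦ by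
    have h1 : (1 - x) ^ (-(b + ν)) = (1 - x) ^ (-b) / (1 - x) ^ ν := by
      rw [neg_add, ← sub_eq_add_neg, rpow_sub_natCast h1x.ne']
    have h2 : -y = (-1 / 2) * s ^ 2 * x / (1 - x) := by rw [hy]; ring
    rw [h1, h2, div_pow, mul_pow, mul_pow, pow_mul]
    ring
  have hdecomp : (1 - x) ^ (-b) * exp (-y)
      - ∑ ν ∈ range N, s ^ (2 * ν) *
          ∑ i ∈ Icc ν (N - 1), (-1 / 2) ^ ν / ν.factorial * d ν (i - ν) * x ^ i
      = (1 - x) ^ (-b) * (exp (-y) - ∑ ν ∈ range N, (-y) ^ ν / ν.factorial)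
        + ∑ ν ∈ range N, (-1 / 2) ^ ν / ν.factorial * s ^ (2 * ν) * x ^ ν *
          ((1 - x) ^ (-(b + ν)) - ∑ l ∈ range (N - ν), d ν l * x ^ l) := by
    rw [sum_congr rfl hcoef, mul_sub, mul_sum, sum_congr rfl hexpand]
    simp only [mul_sub, sum_sub_distrib]
    ring
  have hmain : |(1 - x) ^ (-b) * (exp (-y) - ∑ ν ∈ range N, (-y) ^ ν / ν.factorial)|
      ≤ 2 ^ b * K * |s| ^ (2 * N) * x ^ N := by
    rw [abs_mul, abs_of_pos (by positivity)]
    have h1 : (1 - x) ^ (-b) ≤ 2 ^ b := by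
      rw [rpow_neg h1x.le, ← inv_rpow h1x.le]
      refine rpow_le_rpow (by positivity) ?_ hb.le
      rw [inv_le_comm₀ h1x two_pos]
      linarith
    calc _ ≤ 2 ^ b * (K * (s ^ 2 * x) ^ N) := by
          gcongr
          exact (hK y hy0).trans (by gcongr)
      _ = _ := by rw [mul_pow, pow_mul, sq_abs]; ring
  have hterm : ∀ ν ∈ range N, |(-1 / 2) ^ ν / ν.factorial * s ^ (2 * ν) * x ^ ν *
      ((1 - x) ^ (-(b + ν)) - ∑ l ∈ range (N - ν), d ν l * x ^ l)|
      ≤ D ν (N - ν) * |s| ^ (2 * ν) * x ^ N := fun ν hν ↦ by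
    have hν := mem_range.1 hν
    have h1 : |(-1 / 2 : ℝ) ^ ν / (ν.factorial : ℝ)| ≤ 1 := by
      rw [abs_div, abs_pow, Nat.abs_cast]
      refine div_le_one_of_le₀ ((pow_le_one₀ (abs_nonneg _) ?_).trans ?_) (by positivity)
      · rw [abs_le]; norm_num
      · exact_mod_cast ν.factorial_pos
    rw [abs_mul, abs_mul, abs_mul, abs_pow s, abs_of_nonneg (pow_nonneg hx0 ν)]
    calc _ ≤ 1 * |s| ^ (2 * ν) * x ^ ν * (D ν (N - ν) * x ^ (N - ν)) := by
          gcongr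
          exact hD ν (N - ν) x ⟨hx0, hx1⟩
      _ = D ν (N - ν) * |s| ^ (2 * ν) * (x ^ ν * x ^ (N - ν)) := by ring
      _ = _ := by rw [← pow_add, Nat.add_sub_cancel' hν.le]
  set w : ℝ := exp (-(s ^ 2 / 2)) with hw
  have hw0 : 0 < w := exp_pos _
  rw [hdecomp]
  calc _ ≤ |s| ^ m * w * (2 ^ b * K * |s| ^ (2 * N) * x ^ N
        + ∑ ν ∈ range N, D ν (N - ν) * |s| ^ (2 * ν) * x ^ N) := by
        gcongr
        exact (abs_add_le _ _).trans (add_le_add hmain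
          ((abs_sum_le_sum_abs _ _).trans (sum_le_sum hterm)))
    _ = (2 ^ b * K * (|s| ^ (m + 2 * N) * w)
        + ∑ ν ∈ range N, D ν (N - ν) * (|s| ^ (m + 2 * ν) * w)) * x ^ N := by
        rw [mul_add, add_mul, mul_sum, sum_mul]
        congr 1
        · rw [pow_add]; ring
        · exact sum_congr rfl fun ν _ ↦ by rw [pow_add]; ring
    _ ≤ _ := by
        gcongr with ν hν
        · exact hB _ s
        · exact hD0 _ _
        · exact hB _ s

lemma sum_Icc_two_eq_sum_range (l t : ℝ) (K : ℕ) :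
    ∑ k ∈ Icc 2 K, ((k : ℝ) - t) ^ l = ∑ j ∈ range (K - 1), (1 - t + 1 + j) ^ l := by
  have hIcc : Icc 2 K = Ico 2 (K + 1) := by ext i; simp only [mem_Icc, mem_Ico]; omega
  rw [hIcc, sum_Ico_eq_sum_range, show K + 1 - 2 = K - 1 by omega]
  refine sum_congr rfl fun j _ ↦ ?_
  congr 1
  push_cast
  ring

lemma sum_Icc_half_rpow_neg_le {l : ℝ} (hl0 : 0 < l) (hl1 : l < 1) {n : ℕ} (hn : 4 ≤ n)
    {t : ℝ} (ht : t ∈ Set.Ioo (0 : ℝ) 1) :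
    ∑ k ∈ Icc 2 (n / 2), ((k : ℝ) - t) ^ (-l) ≤ (1 - l)⁻¹ * (n : ℝ) ^ (1 - l) := by
  obtain ⟨ht0, ht1⟩ := ht
  have hp : 0 < 1 - l := by linarith
  rw [sum_Icc_two_eq_sum_range]
  refine (sum_rpow_neg_le_of_lt_one hl0 hl1 (by linarith) _).trans ?_
  have h1 : ((n / 2 - 1 : ℕ) : ℝ) + 1 ≤ n := by
    have : n / 2 - 1 + 1 ≤ n := by omega
    exact_mod_cast this
  have h0 : (0 : ℝ) ≤ 1 - t + ((n / 2 - 1 : ℕ) : ℝ) :=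
    add_nonneg (by linarith) (Nat.cast_nonneg _)
  gcongr
  linarith

lemma abs_tsum_sub_sum_Icc_half_le {l : ℝ} (hl : 1 < l) {n : ℕ} (hn : 4 ≤ n)
    {t : ℝ} (ht : t ∈ Set.Ioo (0 : ℝ) 1) :
    |∑' k : ℕ, ((k : ℝ) + 2 - t) ^ (-l) - ∑ k ∈ Icc 2 (n / 2), ((k : ℝ) - t) ^ (-l)|
      ≤ (l - 1)⁻¹ * 8 ^ (l - 1) * (n : ℝ) ^ (1 - l) := by
  obtain ⟨ht0, ht1⟩ := ht
  have hq : 0 < l - 1 := by linarith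
  have hn4 : (4 : ℝ) ≤ n := by exact_mod_cast hn
  have hshift : ∀ k : ℕ, ((k : ℝ) + 2 - t) ^ (-l) = (1 - t + 1 + k) ^ (-l) := fun k ↦ by
    congr 1; ring
  have hK : (n : ℝ) / 8 ≤ 1 - t + ((n / 2 - 1 : ℕ) : ℝ) := by
    have : n ≤ 2 * (n / 2 - 1) + 3 := by omega
    have : (n : ℝ) ≤ 2 * ((n / 2 - 1 : ℕ) : ℝ) + 3 := by exact_mod_cast this
    have h2 : 1 ≤ n / 2 - 1 := by omega
    have : (1 : ℝ) ≤ ((n / 2 - 1 : ℕ) : ℝ) := by exact_mod_cast h2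
    linarith
  set v : ℝ := 1 - t + ((n / 2 - 1 : ℕ) : ℝ) with hv
  have hv0 : 0 < v := by linarith
  rw [sum_Icc_two_eq_sum_range]
  simp_rw [hshift]
  rw [← (summable_rpow_neg_of_one_lt hl (by linarith : 0 < 1 - t)).sum_add_tsum_nat_add
    (n / 2 - 1), add_sub_cancel_left]
  have hrew : ∀ i : ℕ, (1 - t + 1 + ((i + (n / 2 - 1) : ℕ) : ℝ)) ^ (-l) = (v + 1 + i) ^ (-l) :=
    fun i ↦ by rw [hv, Nat.cast_add]; congr 1; ring
  simp_rw [hrew]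
  rw [abs_of_nonneg (tsum_nonneg fun i ↦ by positivity)]
  refine (tsum_rpow_neg_le_of_one_lt hl hv0).trans ?_
  rw [mul_assoc]
  gcongr
  calc v ^ (1 - l) ≤ ((n : ℝ) / 8) ^ (1 - l) :=
        rpow_le_rpow_of_nonpos (by positivity) hK (by linarith)
    _ = 8 ^ (l - 1) * (n : ℝ) ^ (1 - l) := by
        rw [div_rpow (by positivity) (by positivity), show l - 1 = -(1 - l) by ring,
          rpow_neg (by positivity : (0 : ℝ) ≤ 8)]
        ring

/-- Lemma 3: expansion for `Σ_{k=2}^{⌊n/2⌋} z^m (n−k+t)^{−b} (k−t)^{−a} e^{−z²/(2(n−k+t))}`,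
with coefficients involving `g_λ(t) = Σ_{k≥2} (k−t)^{−λ}`. -/
theorem stmt_8 (a b : ℝ) (ha : 0 < a) (hb : 0 < b) (hna : ∀ k : ℤ, (k : ℝ) ≠ a)
    (m : ℕ) :
    ∃ (c : ℕ → ℕ → ℝ) (C : ℝ), 0 < C ∧
      ∀ n : ℕ, 4 ≤ n → ∀ t ∈ Set.Ioo (0 : ℝ) 1, ∀ z : ℝ,
        |(∑ k ∈ Finset.Icc 2 (n / 2),
            z ^ m * ((n : ℝ) - k + t) ^ (-b) * ((k : ℝ) - t) ^ (-a) *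
              Real.exp (-z ^ 2 / (2 * ((n : ℝ) - k + t))))
          - z ^ m / (n : ℝ) ^ b * Real.exp (-z ^ 2 / (2 * n)) *
              ∑ ν ∈ Finset.range ⌊a⌋₊,
                z ^ (2 * ν) / (n : ℝ) ^ ν *
                  ∑ i ∈ Finset.Icc ν (⌊a⌋₊ - 1),
                    c i ν * (∑' k : ℕ, ((k : ℝ) + 2 - t) ^ (-(a - (i : ℝ)))) *
                      ((n : ℝ) ^ i)⁻¹|
        ≤ C / (n : ℝ) ^ (a + b - (m : ℝ) / 2 - 1) := by
  set N := ⌊a⌋₊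
  have hNlt : (N : ℝ) < a :=
    lt_of_le_of_ne (Nat.floor_le ha.le) (by simpa using hna (N : ℤ))
  have haN : a < N + 1 := Nat.lt_floor_add_one a
  obtain ⟨c, C, hC0, hC⟩ := exists_weighted_expansion hb m N
  choose B hB0 hB using exists_abs_pow_mul_exp_le
  set T : ℕ → ℝ := fun i ↦ (a - i - 1)⁻¹ * 8 ^ (a - i - 1)
  have hi : ∀ ν ∈ range N, ∀ i ∈ Icc ν (N - 1), 1 < a - i := fun ν hν i hi ↦ by
    have hν := mem_range.1 hν
    have hi := (mem_Icc.1 hi).2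
    have : i + 1 ≤ N := by omega
    have : (i : ℝ) + 1 ≤ N := by exact_mod_cast this
    linarith
  have hT0 : ∀ ν ∈ range N, ∀ i ∈ Icc ν (N - 1), 0 ≤ T i := fun ν hν i h ↦ by
    have := hi ν hν i h
    exact mul_nonneg (inv_nonneg.2 (by linarith)) (by positivity)
  set C₁ : ℝ := C * (1 - (a - N))⁻¹ with hC₁
  set C₂ : ℝ := ∑ ν ∈ range N, B (m + 2 * ν) * ∑ i ∈ Icc ν (N - 1), |c i ν| * T i with hC₂
  have hC₁0 : 0 ≤ C₁ := mul_nonneg hC0 (inv_nonneg.2 (by linarith))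
  have hC₂0 : 0 ≤ C₂ := sum_nonneg fun ν hν ↦ mul_nonneg (hB0 _) (sum_nonneg fun i h ↦
    mul_nonneg (abs_nonneg _) (hT0 ν hν i h))
  refine ⟨c, C₁ + C₂ + 1, by positivity, fun n hn t ht z ↦ ?_⟩
  have hn4 : (4 : ℝ) ≤ n := by exact_mod_cast hn
  have hn0 : (0 : ℝ) < n := by linarith
  set r : ℝ := √n with hr
  have hr0 : 0 < r := sqrt_pos.2 hn0
  have hr2 : r ^ 2 = n := sq_sqrt hn0.le
  obtain ⟨s, rfl⟩ : ∃ s, z = s * r := ⟨z / r, by field_simp⟩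
  set w : ℝ := exp (-(s ^ 2 / 2)) with hw
  have hw0 : 0 < w := exp_pos _
  set x : ℕ → ℝ := fun k ↦ ((k : ℝ) - t) / n with hx
  have hk : ∀ k ∈ Icc 2 (n / 2), 0 < (k : ℝ) - t ∧ x k ∈ Set.Icc (0 : ℝ) (1 / 2) := fun k hk ↦ by
    obtain ⟨hk2, hkn⟩ := mem_Icc.1 hk
    have h2 : (2 : ℝ) ≤ k := by exact_mod_cast hk2
    have h3 : 2 * k ≤ n := by omega
    have h3 : 2 * (k : ℝ) ≤ n := by exact_mod_cast h3
    have h4 : 0 < (k : ℝ) - t := by linarith [ht.2]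
    refine ⟨h4, by positivity, ?_⟩
    rw [hx, div_le_iff₀ hn0]
    linarith [ht.1]
  set G : ℕ → ℝ := fun i ↦ ∑' k : ℕ, ((k : ℝ) + 2 - t) ^ (-(a - (i : ℝ)))
  set H : ℕ → ℝ := fun i ↦ ∑ k ∈ Icc 2 (n / 2), ((k : ℝ) - t) ^ (-(a - (i : ℝ))) with hH
  set F : ℕ → ℝ := fun k ↦ (1 - x k) ^ (-b) * exp (-(s ^ 2 / 2 * (x k / (1 - x k))))
  set S : ℕ → ℝ := fun k ↦ ∑ ν ∈ range N, s ^ (2 * ν) * ∑ i ∈ Icc ν (N - 1), c i ν * x k ^ i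
    with hS
  have hpow : ∀ k ∈ Icc 2 (n / 2), ∀ i : ℕ,
      ((k : ℝ) - t) ^ (-a) * x k ^ i = ((k : ℝ) - t) ^ (-(a - (i : ℝ))) * ((n : ℝ) ^ i)⁻¹ :=
    fun k hk' i ↦ by
    rw [hx, div_pow, show -(a - (i : ℝ)) = -a + i by ring, rpow_add_natCast (hk k hk').1.ne']
    ring
  have hsummand : ∀ k ∈ Icc 2 (n / 2),
      (s * r) ^ m * ((n : ℝ) - k + t) ^ (-b) * ((k : ℝ) - t) ^ (-a) *
          exp (-(s * r) ^ 2 / (2 * ((n : ℝ) - k + t)))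
        = (n : ℝ) ^ (-b) * r ^ m * (((k : ℝ) - t) ^ (-a) * (s ^ m * w * F k)) := fun k hk' ↦ by
    obtain ⟨-, hx0, hx1⟩ := hk k hk'
    have h1x : 0 < 1 - x k := by linarith
    have h1 : (n : ℝ) - k + t = n * (1 - x k) := by rw [hx]; field_simp; ring
    have h2 : exp (-(s * r) ^ 2 / (2 * (n * (1 - x k))))
        = w * exp (-(s ^ 2 / 2 * (x k / (1 - x k)))) := by
      rw [hw, ← exp_add, mul_pow, hr2]
      congr 1
      field_simp
      ring
    rw [h1, h2, mul_rpow hn0.le h1x.le, mul_pow]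
    ring
  have hswap : ∑ k ∈ Icc 2 (n / 2), ((k : ℝ) - t) ^ (-a) * S k
      = ∑ ν ∈ range N, s ^ (2 * ν) * ∑ i ∈ Icc ν (N - 1), c i ν * H i * ((n : ℝ) ^ i)⁻¹ := by
    simp only [hS, hH, mul_sum, sum_mul]
    rw [sum_comm]
    refine sum_congr rfl fun ν _ ↦ ?_
    rw [sum_comm]
    refine sum_congr rfl fun i _ ↦ sum_congr rfl fun k hk' ↦ ?_
    calc _ = s ^ (2 * ν) * c i ν * (((k : ℝ) - t) ^ (-a) * x k ^ i) := by ring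
      _ = _ := by rw [hpow k hk' i]; ring
  have hratio : ∀ ν : ℕ, (s * r) ^ (2 * ν) / (n : ℝ) ^ ν = s ^ (2 * ν) := fun ν ↦ by
    rw [mul_pow, pow_mul r, hr2]
    field_simp
  have hexp : exp (-(s * r) ^ 2 / (2 * n)) = w := by
    rw [hw, mul_pow, hr2]
    congr 1
    field_simp
  have hdecomp : (∑ k ∈ Icc 2 (n / 2), (s * r) ^ m * ((n : ℝ) - k + t) ^ (-b) *
        ((k : ℝ) - t) ^ (-a) * exp (-(s * r) ^ 2 / (2 * ((n : ℝ) - k + t))))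
      - (s * r) ^ m / (n : ℝ) ^ b * exp (-(s * r) ^ 2 / (2 * n)) *
        ∑ ν ∈ range N, (s * r) ^ (2 * ν) / (n : ℝ) ^ ν *
          ∑ i ∈ Icc ν (N - 1), c i ν * G i * ((n : ℝ) ^ i)⁻¹
      = (n : ℝ) ^ (-b) * r ^ m *
        (∑ k ∈ Icc 2 (n / 2), ((k : ℝ) - t) ^ (-a) * (s ^ m * w * (F k - S k))
          - ∑ ν ∈ range N, s ^ m * w * s ^ (2 * ν) *
            ∑ i ∈ Icc ν (N - 1), c i ν * (G i - H i) * ((n : ℝ) ^ i)⁻¹) := by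
    have e1 : ∑ k ∈ Icc 2 (n / 2), ((k : ℝ) - t) ^ (-a) * (s ^ m * w * (F k - S k))
        = ∑ k ∈ Icc 2 (n / 2), ((k : ℝ) - t) ^ (-a) * (s ^ m * w * F k)
          - s ^ m * w * ∑ k ∈ Icc 2 (n / 2), ((k : ℝ) - t) ^ (-a) * S k := by
      rw [mul_sum, ← sum_sub_distrib]
      exact sum_congr rfl fun k _ ↦ by ring
    have e2 : ∑ ν ∈ range N, s ^ m * w * s ^ (2 * ν) *
            ∑ i ∈ Icc ν (N - 1), c i ν * (G i - H i) * ((n : ℝ) ^ i)⁻¹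
        = s ^ m * w * ∑ ν ∈ range N, s ^ (2 * ν) *
            ∑ i ∈ Icc ν (N - 1), c i ν * G i * ((n : ℝ) ^ i)⁻¹
          - s ^ m * w * ∑ ν ∈ range N, s ^ (2 * ν) *
            ∑ i ∈ Icc ν (N - 1), c i ν * H i * ((n : ℝ) ^ i)⁻¹ := by
      simp only [mul_sub, sub_mul, sum_sub_distrib, mul_sum, mul_assoc]
    rw [e1, e2, hswap, hexp, sum_congr rfl hsummand, ← mul_sum]
    simp_rw [hratio]
    rw [rpow_neg hn0.le, mul_pow]
    ring
  have hhead : |∑ k ∈ Icc 2 (n / 2), ((k : ℝ) - t) ^ (-a) * (s ^ m * w * (F k - S k))|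
      ≤ C₁ * (n : ℝ) ^ (1 - a) := by
    calc _ ≤ ∑ k ∈ Icc 2 (n / 2), C * (((k : ℝ) - t) ^ (-(a - N)) * ((n : ℝ) ^ N)⁻¹) := by
          refine (abs_sum_le_sum_abs _ _).trans (sum_le_sum fun k hk' ↦ ?_)
          have hkt := (hk k hk').1
          rw [abs_mul, abs_mul, abs_mul, abs_pow, abs_of_pos hw0, abs_of_pos (by positivity),
            ← hpow k hk' N]
          calc _ ≤ ((k : ℝ) - t) ^ (-a) * (C * x k ^ N) := by
                refine mul_le_mul_of_nonneg_left ?_ (by positivity)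
                exact hC (x k) (hk k hk').2 s
            _ = _ := by ring
      _ = C * ((∑ k ∈ Icc 2 (n / 2), ((k : ℝ) - t) ^ (-(a - N))) * ((n : ℝ) ^ N)⁻¹) := by
          rw [← mul_sum, sum_mul]
      _ ≤ C * (((1 - (a - N))⁻¹ * (n : ℝ) ^ (1 - (a - N))) * ((n : ℝ) ^ N)⁻¹) := by
          gcongr
          exact sum_Icc_half_rpow_neg_le (by linarith) (by linarith) hn ht
      _ = _ := by
          rw [show 1 - (a - N) = 1 - a + N by ring, rpow_add_natCast hn0.ne', hC₁,
            show 1 - (a - N) = 1 - a + N by ring]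
          field_simp
  have htail : |∑ ν ∈ range N, s ^ m * w * s ^ (2 * ν) *
      ∑ i ∈ Icc ν (N - 1), c i ν * (G i - H i) * ((n : ℝ) ^ i)⁻¹| ≤ C₂ * (n : ℝ) ^ (1 - a) := by
    rw [hC₂, sum_mul]
    refine (abs_sum_le_sum_abs _ _).trans (sum_le_sum fun ν hν ↦ ?_)
    have hweight : |s ^ m * w * s ^ (2 * ν)| ≤ B (m + 2 * ν) := by
      rw [abs_mul, abs_mul, abs_pow, abs_pow, abs_of_pos hw0]
      refine le_trans (le_of_eq ?_) (hB (m + 2 * ν) s)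
      rw [pow_add]
      ring
    have hinner : |∑ i ∈ Icc ν (N - 1), c i ν * (G i - H i) * ((n : ℝ) ^ i)⁻¹|
        ≤ (∑ i ∈ Icc ν (N - 1), |c i ν| * T i) * (n : ℝ) ^ (1 - a) := by
      rw [sum_mul]
      refine (abs_sum_le_sum_abs _ _).trans (sum_le_sum fun i hi' ↦ ?_)
      rw [abs_mul, abs_mul, abs_of_pos (show 0 < ((n : ℝ) ^ i)⁻¹ by positivity)]
      calc _ ≤ |c i ν| * (T i * (n : ℝ) ^ (1 - (a - i))) * ((n : ℝ) ^ i)⁻¹ := by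
            gcongr
            exact abs_tsum_sub_sum_Icc_half_le (hi ν hν i hi') hn ht
        _ = _ := by
            rw [show 1 - (a - (i : ℝ)) = 1 - a + i by ring, rpow_add_natCast hn0.ne']
            field_simp
    rw [abs_mul, mul_assoc (B _)]
    exact mul_le_mul hweight hinner (abs_nonneg _) (hB0 _)
  have hscale : (n : ℝ) ^ (-b) * r ^ m * (n : ℝ) ^ (1 - a)
      = ((n : ℝ) ^ (a + b - (m : ℝ) / 2 - 1))⁻¹ := by
    have hrm : r ^ m = (n : ℝ) ^ ((m : ℝ) / 2) := by
      rw [hr, sqrt_eq_rpow, ← rpow_mul_natCast hn0.le]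
      congr 1
      ring
    rw [hrm, ← rpow_add hn0, ← rpow_add hn0, ← rpow_neg hn0.le]
    congr 1
    ring
  rw [hdecomp, abs_mul, abs_of_pos (by positivity), div_eq_mul_inv, ← hscale]
  calc _ ≤ (n : ℝ) ^ (-b) * r ^ m * (C₁ * (n : ℝ) ^ (1 - a) + C₂ * (n : ℝ) ^ (1 - a)) := by
        gcongr
        exact (abs_sub _ _).trans (add_le_add hhead htail)
    _ = (C₁ + C₂) * ((n : ℝ) ^ (-b) * r ^ m * (n : ℝ) ^ (1 - a)) := by ring
    _ ≤ _ := mul_le_mul_of_nonneg_right (by linarith) (by positivity)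
end

section
/- Let j, ℓ, m, p be nonnegative integers with m ≤ 2(j+ℓ+p). For an integer n ≥ 4 and a real z ≠ 0, let g_{n,z}(u) := z^m · (n−u)^{−(j+1/2)} · u^{−(ℓ+1/2)} · e^{−z²/(2u)} for 0 < u < n, and let g_{n,z}^{(p)} denote its p-th derivative in u. Then there exist polynomials P₀, …, P_{j+p−1} with real coefficients, where P_i has degree at most i, and a constant C > 0 such that for all integers n ≥ 4 and all reals z ≠ 0, |∫_0^1 (B_p(u) − B_p) · Σ_{k=1}^{n−2} g_{n,z}^{(p)}(k+1−u) du − e^{−z²/(2n)} · (z^m/n^{ℓ+1/2}) · Σ_{i=0}^{j+p−1} P_i(z²/n) · n^{−i}| ≤ C / min(n^{j+ℓ+p−m/2}, |z|^{2(j+ℓ+p)−m}). -/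
open Finset Real MeasureTheory intervalIntegral

/-- The polynomials `Q_r` for which the `r`-th derivative of `w ^ (-(ℓ + 1/2)) * exp (-y / (2 w))`
is `w ^ (-(ℓ + 1/2 + r)) * Q_r (y / w) * exp (-y / (2 w))`. -/
noncomputable def gaussPoly (ℓ : ℕ) : ℕ → Polynomial ℝ
  | 0 => 1
  | r + 1 => -(Polynomial.C ((ℓ : ℝ) + 1 / 2 + r) * gaussPoly ℓ r)
      - Polynomial.X * (gaussPoly ℓ r).derivative
      + Polynomial.C (1 / 2) * Polynomial.X * gaussPoly ℓ r

/-- The `r`-th derivative of `w ^ (-(ℓ + 1/2)) * exp (-y / (2 w))`. -/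
noncomputable def gaussJet (ℓ : ℕ) (y : ℝ) (r : ℕ) (w : ℝ) : ℝ :=
  w ^ (-((ℓ : ℝ) + 1 / 2 + r)) * (gaussPoly ℓ r).eval (y / w) * Real.exp (-y / (2 * w))

/-- The `a`-th derivative of `w ↦ (x - w) ^ (-(j + 1/2))`. -/
noncomputable def powJet (j : ℕ) (x : ℝ) (a : ℕ) (w : ℝ) : ℝ :=
  (ascPochhammer ℝ a).eval ((j : ℝ) + 1 / 2) * (x - w) ^ (-((j : ℝ) + 1 / 2 + a))

lemma natDegree_gaussPoly_le (ℓ r : ℕ) : (gaussPoly ℓ r).natDegree ≤ r := by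
  induction r with
  | zero => simp [gaussPoly]
  | succ r ih =>
    have hd : (Polynomial.X * (gaussPoly ℓ r).derivative).natDegree ≤ r + 1 := by
      refine Polynomial.natDegree_mul_le.trans ?_
      have := Polynomial.natDegree_derivative_le (gaussPoly ℓ r)
      have := Polynomial.natDegree_X_le (R := ℝ)
      omega
    have hc : (Polynomial.C ((ℓ : ℝ) + 1 / 2 + r) * gaussPoly ℓ r).natDegree ≤ r + 1 :=
      (Polynomial.natDegree_C_mul_le _ _).trans (ih.trans (Nat.le_succ r))
    have hx : (Polynomial.C (1 / 2 : ℝ) * Polynomial.X * gaussPoly ℓ r).natDegree ≤ r + 1 := by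
      rw [mul_assoc]
      refine (Polynomial.natDegree_C_mul_le _ _).trans (Polynomial.natDegree_mul_le.trans ?_)
      have := Polynomial.natDegree_X_le (R := ℝ)
      omega
    rw [gaussPoly]
    refine Polynomial.natDegree_add_le_of_degree_le
      ((Polynomial.natDegree_sub_le_of_le (m := r + 1) ?_ hd).trans (by simp)) hx
    rwa [Polynomial.natDegree_neg]

lemma hasDerivAt_gaussJet (ℓ : ℕ) (y : ℝ) (r : ℕ) {w : ℝ} (hw : 0 < w) :
    HasDerivAt (gaussJet ℓ y r) (gaussJet ℓ y (r + 1) w) w := by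
  have hw' := hw.ne'
  have h1 := Real.hasDerivAt_rpow_const (x := w) (p := -((ℓ : ℝ) + 1 / 2 + r)) (Or.inl hw')
  have hdiv : HasDerivAt (fun w : ℝ => y / w) (-y / w ^ 2) w := by
    simpa using (hasDerivAt_const w y).fun_div (hasDerivAt_id w) hw'
  have h2 := ((gaussPoly ℓ r).hasDerivAt (y / w)).comp w hdiv
  have hexp : HasDerivAt (fun w : ℝ => -y / (2 * w)) (y * 2 / (2 * w) ^ 2) w := by
    simpa using (hasDerivAt_const w (-y)).fun_div ((hasDerivAt_id w).const_mul 2) (by simpa using hw')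
  have h := (h1.mul h2).mul hexp.exp
  refine h.congr_deriv ?_
  have e1 : w ^ (-((ℓ : ℝ) + 1 / 2 + r) - 1) = w ^ (-((ℓ : ℝ) + 1 / 2 + r)) / w := by
    rw [Real.rpow_sub_one hw']
  have e2 : w ^ (-((ℓ : ℝ) + 1 / 2 + (r + 1 : ℕ))) = w ^ (-((ℓ : ℝ) + 1 / 2 + r)) / w := by
    rw [← Real.rpow_sub_one hw']; push_cast; ring_nf
  simp only [gaussJet, gaussPoly, e1, e2, Function.comp, Polynomial.eval_add, Polynomial.eval_sub,
    Polynomial.eval_neg, Polynomial.eval_mul, Polynomial.eval_C, Polynomial.eval_X, Pi.mul_apply]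
  field_simp
  ring

lemma hasDerivAt_powJet (j : ℕ) (x : ℝ) (a : ℕ) {w : ℝ} (hw : w < x) :
    HasDerivAt (powJet j x a) (powJet j x (a + 1) w) w := by
  have h1 := ((hasDerivAt_id w).const_sub x).rpow_const (p := -((j : ℝ) + 1 / 2 + a))
    (Or.inl (sub_pos.2 hw).ne')
  refine (h1.const_mul ((ascPochhammer ℝ a).eval ((j : ℝ) + 1 / 2))).congr_deriv ?_
  have e : -((j : ℝ) + 1 / 2 + (a + 1 : ℕ)) = -((j : ℝ) + 1 / 2 + a) - 1 := by push_cast; ring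
  rw [powJet, ascPochhammer_succ_eval, e, id]
  ring

lemma iteratedDeriv_eq_of_hasDerivAt {f : ℕ → ℝ → ℝ} {s : Set ℝ} (hs : IsOpen s)
    (hf : ∀ k, ∀ x ∈ s, HasDerivAt (f k) (f (k + 1) x) x) (k : ℕ) :
    ∀ x ∈ s, iteratedDeriv k (f 0) x = f k x := by
  induction k with
  | zero => simp
  | succ k ih =>
    intro x hx
    rw [iteratedDeriv_succ]
    have h : iteratedDeriv k (f 0) =ᶠ[nhds x] f k := by
      filter_upwards [hs.mem_nhds hx] with t ht using ih t ht
    rw [h.deriv_eq, (hf k x hx).deriv]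

lemma iteratedDeriv_pow_mul_gauss (j ℓ m p : ℕ) (x z : ℝ) {w : ℝ} (hw : 0 < w) (hwx : w < x) :
    iteratedDeriv p (fun w : ℝ => z ^ m * (x - w) ^ (-((j : ℝ) + 1 / 2)) *
        w ^ (-((ℓ : ℝ) + 1 / 2)) * Real.exp (-z ^ 2 / (2 * w))) w =
      z ^ m * ∑ a ∈ range (p + 1), (p.choose a : ℝ) * powJet j x a w *
        gaussJet ℓ (z ^ 2) (p - a) w := by
  have hfun : (fun w : ℝ => z ^ m * (x - w) ^ (-((j : ℝ) + 1 / 2)) *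
        w ^ (-((ℓ : ℝ) + 1 / 2)) * Real.exp (-z ^ 2 / (2 * w))) =
      fun w => z ^ m * (powJet j x 0 * gaussJet ℓ (z ^ 2) 0) w := by
    funext t
    simp [powJet, gaussJet, gaussPoly]
    ring
  have hxw := (sub_pos.2 hwx).ne'
  have hpow : ContDiffAt ℝ p (powJet j x 0) w := by
    unfold powJet
    exact contDiffAt_const.mul ((contDiffAt_const.sub contDiffAt_id).rpow_const_of_ne hxw)
  have hgauss : ContDiffAt ℝ p (gaussJet ℓ (z ^ 2) 0) w := by
    unfold gaussJet
    simp only [gaussPoly, Polynomial.eval_one]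
    exact ((contDiffAt_id.rpow_const_of_ne hw.ne').mul contDiffAt_const).mul
      (contDiffAt_const.div (contDiffAt_const.mul contDiffAt_id) (by simpa using hw.ne')).exp
  rw [hfun, iteratedDeriv_const_mul_field, iteratedDeriv_mul hpow hgauss]
  congr 1
  refine sum_congr rfl fun a _ => ?_
  rw [iteratedDeriv_eq_of_hasDerivAt isOpen_Iio (fun k t ht => hasDerivAt_powJet j x k ht) a w hwx,
    iteratedDeriv_eq_of_hasDerivAt isOpen_Ioi
      (fun k t ht => hasDerivAt_gaussJet ℓ (z ^ 2) k ht) (p - a) w hw]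

lemma taylor_jet_bound {f : ℕ → ℝ → ℝ} {a x K : ℝ}
    (hf : ∀ r, ∀ w ∈ Set.Icc a x, HasDerivAt (f r) (f (r + 1) w) w) (d : ℕ) :
    ∀ r, (∀ w ∈ Set.Icc a x, |f (r + d) w| ≤ K) → ∀ w ∈ Set.Icc a x,
      |f r w - ∑ i ∈ range d, f (r + i) x * ((-1) ^ i / (i.factorial : ℝ)) * (x - w) ^ i| ≤
        K * (x - w) ^ d := by
  induction d with
  | zero => intro r hK w hw; simpa using hK w hw
  | succ d ih =>
    intro r hK w hw
    have hsub : Set.Icc w x ⊆ Set.Icc a x := Set.Icc_subset_Icc_left hw.1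
    have hK0 : 0 ≤ K := (abs_nonneg _).trans (hK w hw)
    set ψ : ℝ → ℝ := fun w =>
      f r w - ∑ i ∈ range (d + 1), f (r + i) x * ((-1) ^ i / (i.factorial : ℝ)) * (x - w) ^ i
    have hψ : ∀ t ∈ Set.Icc w x, HasDerivWithinAt ψ (f (r + 1) t -
        ∑ i ∈ range d, f (r + 1 + i) x * ((-1) ^ i / (i.factorial : ℝ)) * (x - t) ^ i)
        (Set.Icc w x) t := by
      intro t ht
      have h1 : HasDerivAt (fun w => ∑ i ∈ range (d + 1),
          f (r + i) x * ((-1) ^ i / (i.factorial : ℝ)) * (x - w) ^ i)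
          (∑ i ∈ range (d + 1), f (r + i) x * ((-1) ^ i / (i.factorial : ℝ)) *
            (i * (x - t) ^ (i - 1) * (-1))) t :=
        HasDerivAt.fun_sum fun i _ =>
          (((hasDerivAt_id t).const_sub x).fun_pow i).const_mul _
      refine (((hf r t (hsub ht)).sub h1).congr_deriv ?_).hasDerivWithinAt
      rw [sum_range_succ']
      simp only [Nat.cast_zero, zero_mul, mul_zero, add_zero]
      congr 1
      refine sum_congr rfl fun i _ => ?_
      rw [Nat.factorial_succ, add_tsub_cancel_right, show r + (i + 1) = r + 1 + i by ring]
      have : (i.factorial : ℝ) ≠ 0 := by positivity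
      have : ((i : ℝ) + 1) ≠ 0 := by positivity
      push_cast
      field_simp
      ring
    have hbound : ∀ t ∈ Set.Icc w x, ‖f (r + 1) t -
        ∑ i ∈ range d, f (r + 1 + i) x * ((-1) ^ i / (i.factorial : ℝ)) * (x - t) ^ i‖ ≤
        K * (x - w) ^ d := by
      intro t ht
      refine (ih (r + 1) (fun s hs => ?_) t (hsub ht)).trans ?_
      · rw [show r + 1 + d = r + (d + 1) by ring]
        exact hK s hs
      · have := sub_nonneg.2 ht.2
        have := ht.1
        gcongr
    have hψx : ψ x = 0 := by
      simp [ψ, sum_range_succ']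
    have h := (convex_Icc w x).norm_image_sub_le_of_norm_hasDerivWithin_le hψ hbound
      (Set.left_mem_Icc.2 hw.2) (Set.right_mem_Icc.2 hw.2)
    rw [hψx, zero_sub, norm_neg, Real.norm_eq_abs, Real.norm_eq_abs,
      abs_of_nonneg (sub_nonneg.2 hw.2)] at h
    rwa [pow_succ, ← mul_assoc]

lemma exists_eval_le_mul_exp (Q : Polynomial ℝ) :
    ∃ C : ℝ, 0 < C ∧ ∀ t : ℝ, 0 ≤ t → |Q.eval t| ≤ C * Real.exp (t / 2) := by
  induction Q using Polynomial.induction_on' with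
  | add P Q hP hQ =>
    obtain ⟨C, hC, hP⟩ := hP
    obtain ⟨D, hD, hQ⟩ := hQ
    refine ⟨C + D, by positivity, fun t ht => ?_⟩
    rw [Polynomial.eval_add, add_mul]
    exact (abs_add_le _ _).trans (add_le_add (hP t ht) (hQ t ht))
  | monomial k c =>
    refine ⟨|c| * 2 ^ k * k.factorial + 1, by positivity, fun t ht => ?_⟩
    have h := Real.pow_div_factorial_le_exp (t / 2) (by positivity) k
    rw [div_pow, div_div, div_le_iff₀ (by positivity)] at h
    rw [Polynomial.eval_monomial, abs_mul, abs_of_nonneg (pow_nonneg ht k)]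
    have := Real.exp_pos (t / 2)
    nlinarith [mul_le_mul_of_nonneg_left h (abs_nonneg c)]

lemma exists_gaussJet_bound (ℓ i M : ℕ) :
    ∃ C : ℝ, 0 < C ∧ ∀ y : ℝ, 0 ≤ y → ∀ w : ℝ, 0 < w →
      y ^ M * |gaussJet ℓ y i w| ≤ C * (w ^ M * w ^ (-((ℓ : ℝ) + 1 / 2 + i))) := by
  obtain ⟨C, hC, h⟩ := exists_eval_le_mul_exp (Polynomial.X ^ M * gaussPoly ℓ i)
  refine ⟨C, hC, fun y hy w hw => ?_⟩
  have h := h (y / w) (by positivity)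
  rw [Polynomial.eval_mul, abs_mul, Polynomial.eval_pow, Polynomial.eval_X,
    abs_of_nonneg (by positivity : 0 ≤ (y / w) ^ M), div_pow] at h
  have he : Real.exp (-y / (2 * w)) * Real.exp (y / w / 2) = 1 := by
    rw [← Real.exp_add, Real.exp_eq_one_iff]
    field_simp
    ring
  rw [gaussJet, abs_mul, abs_mul, Real.abs_exp, abs_of_pos (Real.rpow_pos_of_pos hw _)]
  calc y ^ M * (w ^ (-((ℓ : ℝ) + 1 / 2 + i)) * |(gaussPoly ℓ i).eval (y / w)| *
        Real.exp (-y / (2 * w)))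
      = w ^ M * w ^ (-((ℓ : ℝ) + 1 / 2 + i)) * Real.exp (-y / (2 * w)) *
        (y ^ M / w ^ M * |(gaussPoly ℓ i).eval (y / w)|) := by field_simp
    _ ≤ w ^ M * w ^ (-((ℓ : ℝ) + 1 / 2 + i)) * Real.exp (-y / (2 * w)) *
        (C * Real.exp (y / w / 2)) := by gcongr
    _ = C * (w ^ M * w ^ (-((ℓ : ℝ) + 1 / 2 + i))) *
        (Real.exp (-y / (2 * w)) * Real.exp (y / w / 2)) := by ring
    _ = _ := by rw [he, mul_one]

lemma rpow_neg_add_half {v : ℝ} (hv : 0 < v) (k : ℕ) :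
    v ^ (-((k : ℝ) + 1 / 2)) = (v ^ k * √v)⁻¹ := by
  rw [Real.rpow_neg hv.le, Real.rpow_add hv, Real.rpow_natCast, Real.sqrt_eq_rpow]

/-- The coefficient of `v ^ (-(j + p - i) - 1/2)` in the expansion of the `p`-th derivative of
`(x - w) ^ (-(j + 1/2)) * h w` at `w = x - v`, the `i`-th derivative of `h` at `x` factored out. -/
noncomputable def expansionCoeff (j p i : ℕ) : ℝ :=
  ∑ a ∈ range (p + 1), (p.choose a : ℝ) * (ascPochhammer ℝ a).eval ((j : ℝ) + 1 / 2) *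
    if p - a ≤ i then (-1) ^ (i - (p - a)) / ((i - (p - a)).factorial : ℝ) else 0

lemma sum_expansionCoeff (j p : ℕ) (f : ℕ → ℝ) {x v : ℝ} (hv : 0 < v) :
    ∑ i ∈ range (j + p), f i * expansionCoeff j p i * (v ^ (j + p - i) * √v)⁻¹ =
      ∑ a ∈ range (p + 1), (p.choose a : ℝ) * powJet j x a (x - v) *
        ∑ i ∈ range (j + a), f (p - a + i) * ((-1) ^ i / (i.factorial : ℝ)) * v ^ i := by
  simp only [expansionCoeff, mul_sum, sum_mul]
  rw [sum_comm]
  refine sum_congr rfl fun a ha => ?_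
  have hap : a ≤ p := Nat.lt_succ_iff.1 (mem_range.1 ha)
  rw [show j + p = p - a + (j + a) by omega, sum_range_add, sum_eq_zero, zero_add]
  · refine sum_congr rfl fun i hi => ?_
    have hi := mem_range.1 hi
    rw [if_pos (Nat.le_add_right _ _), powJet, sub_sub_cancel, add_tsub_cancel_left,
      show p - a + (j + a) - (p - a + i) = j + a - i by omega,
      show (j : ℝ) + 1 / 2 + a = ((j + a : ℕ) : ℝ) + 1 / 2 by push_cast; ring,
      rpow_neg_add_half hv, show (v ^ (j + a) : ℝ) = v ^ (j + a - i) * v ^ i by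
        rw [← pow_add]; congr 1; omega]
    have := Real.sqrt_pos.2 hv
    field_simp
  · intro i hi
    rw [if_neg (not_le.2 (mem_range.1 hi))]
    simp

lemma leibniz_expansion_bound (j ℓ p : ℕ) {x y K v : ℝ}
    (hK : ∀ w : ℝ, 0 < w → |gaussJet ℓ y (j + p) w| ≤ K * (√w)⁻¹) (hv : 0 < v) (hvx : v < x) :
    |∑ a ∈ range (p + 1), (p.choose a : ℝ) * powJet j x a (x - v) * gaussJet ℓ y (p - a) (x - v) -
        ∑ i ∈ range (j + p), gaussJet ℓ y i x * expansionCoeff j p i *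
          (v ^ (j + p - i) * √v)⁻¹| ≤
      (∑ a ∈ range (p + 1), (p.choose a : ℝ) * (ascPochhammer ℝ a).eval ((j : ℝ) + 1 / 2)) *
        K * ((√v)⁻¹ * (√(x - v))⁻¹) := by
  have hxv : 0 < x - v := sub_pos.2 hvx
  have hK0 : 0 ≤ K := by
    have := (abs_nonneg _).trans (hK 1 one_pos)
    simpa using this
  rw [sum_expansionCoeff j p (fun i => gaussJet ℓ y i x) (x := x) hv, ← sum_sub_distrib, sum_mul,
    sum_mul]
  refine (abs_sum_le_sum_abs _ _).trans (sum_le_sum fun a ha => ?_)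
  have hap : a ≤ p := Nat.lt_succ_iff.1 (mem_range.1 ha)
  have hT := taylor_jet_bound (f := gaussJet ℓ y) (a := x - v) (x := x) (K := K * (√(x - v))⁻¹)
    (fun r w hw => hasDerivAt_gaussJet ℓ y r (hxv.trans_le hw.1)) (j + a) (p - a)
    (fun w hw => by
      rw [show p - a + (j + a) = j + p by omega]
      refine (hK w (hxv.trans_le hw.1)).trans ?_
      have := Real.sqrt_pos.2 hxv
      have := Real.sqrt_le_sqrt hw.1
      gcongr) (x - v) ⟨le_rfl, by linarith⟩
  rw [sub_sub_cancel] at hT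
  have hpoch : 0 < (ascPochhammer ℝ a).eval ((j : ℝ) + 1 / 2) :=
    ascPochhammer_pos a _ (by positivity)
  have hsv := Real.sqrt_pos.2 hv
  rw [← mul_sub, abs_mul, powJet, sub_sub_cancel,
    show (j : ℝ) + 1 / 2 + a = ((j + a : ℕ) : ℝ) + 1 / 2 by push_cast; ring,
    rpow_neg_add_half hv, abs_of_nonneg (by positivity)]
  refine (mul_le_mul_of_nonneg_left hT (by positivity)).trans_eq ?_
  field_simp

lemma sum_inv_sqrt_le (s : ℕ) : ∑ q ∈ range s, (√((q : ℝ) + 1))⁻¹ ≤ 2 * √s := by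
  induction s with
  | zero => simp
  | succ s ih =>
    rw [sum_range_succ]
    have h1 : 0 < √((s : ℝ) + 1) := Real.sqrt_pos.2 (by positivity)
    have h0 : 0 ≤ √(s : ℝ) := Real.sqrt_nonneg _
    have e1 : √((s : ℝ) + 1) ^ 2 = s + 1 := Real.sq_sqrt (by positivity)
    have e0 : √(s : ℝ) ^ 2 = s := Real.sq_sqrt (by positivity)
    have : (√((s : ℝ) + 1))⁻¹ ≤ 2 * √((s : ℝ) + 1) - 2 * √s := by
      rw [inv_le_iff_one_le_mul₀ h1]
      nlinarith [sq_nonneg (√((s : ℝ) + 1) - √s)]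
    push_cast
    linarith

lemma inv_sqrt_mul_inv_sqrt_le {A B : ℝ} (hA : 0 < A) (hB : 0 < B) :
    (√A)⁻¹ * (√B)⁻¹ ≤ (√(A + B))⁻¹ * ((√A)⁻¹ + (√B)⁻¹) := by
  have hA' := Real.sqrt_pos.2 hA
  have hB' := Real.sqrt_pos.2 hB
  have h : √(A + B) ≤ √A + √B := by
    rw [Real.sqrt_le_left (by positivity)]
    nlinarith [Real.sq_sqrt hA.le, Real.sq_sqrt hB.le, mul_pos hA' hB']
  have hAB : 0 < √(A + B) := Real.sqrt_pos.2 (by positivity)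
  have e : (√A)⁻¹ + (√B)⁻¹ = (√A + √B) * ((√A)⁻¹ * (√B)⁻¹) := by field_simp; ring
  rw [e, ← mul_assoc]
  refine le_mul_of_one_le_left (by positivity) ?_
  rw [inv_mul_eq_div, one_le_div hAB]
  exact h

lemma sum_inv_sqrt_mul_inv_sqrt_le (s : ℕ) :
    ∑ q ∈ range s, (√((q : ℝ) + 1))⁻¹ * (√((s : ℝ) - q))⁻¹ ≤ 4 := by
  have hpos : 0 < √((s : ℝ) + 1) := Real.sqrt_pos.2 (by positivity)
  have hrefl : ∑ q ∈ range s, (√((s : ℝ) - q))⁻¹ = ∑ q ∈ range s, (√((q : ℝ) + 1))⁻¹ := by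
    rw [← sum_range_reflect]
    refine sum_congr rfl fun q hq => ?_
    have hq := mem_range.1 hq
    rw [show s - 1 - q = s - (q + 1) by omega, Nat.cast_sub hq]
    push_cast
    ring_nf
  calc ∑ q ∈ range s, (√((q : ℝ) + 1))⁻¹ * (√((s : ℝ) - q))⁻¹
      ≤ ∑ q ∈ range s, (√((s : ℝ) + 1))⁻¹ * ((√((q : ℝ) + 1))⁻¹ + (√((s : ℝ) - q))⁻¹) := by
        refine sum_le_sum fun q hq => ?_
        have hq : (q : ℝ) < s := by exact_mod_cast mem_range.1 hq
        have := inv_sqrt_mul_inv_sqrt_le (A := (q : ℝ) + 1) (B := s - q) (by positivity)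
          (by linarith)
        rwa [show (q : ℝ) + 1 + (s - q) = s + 1 by ring] at this
    _ = (√((s : ℝ) + 1))⁻¹ * (2 * ∑ q ∈ range s, (√((q : ℝ) + 1))⁻¹) := by
        rw [← mul_sum, sum_add_distrib, hrefl, two_mul]
    _ ≤ (√((s : ℝ) + 1))⁻¹ * (2 * (2 * √((s : ℝ) + 1))) := by
        have := sum_inv_sqrt_le s
        have : √(s : ℝ) ≤ √((s : ℝ) + 1) := Real.sqrt_le_sqrt (by linarith)
        gcongr
        linarith
    _ = 4 := by field_simp; norm_num

lemma sum_shift_inv_le (k s : ℕ) (hs : 0 < s) (n : ℕ) :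
    ∑ q ∈ range n, (((q + s : ℕ) + 1 : ℝ) ^ (k + 1) * √((q + s : ℕ) + 1 : ℝ))⁻¹ ≤
      2 * ((s : ℝ) ^ k * √s)⁻¹ := by
  have hs' : (0 : ℝ) < s := by exact_mod_cast hs
  have hstep : ∀ t : ℝ, 0 < t → s ≤ t → ((t + 1) ^ (k + 1) * √(t + 1))⁻¹ ≤
      2 * ((s : ℝ) ^ k)⁻¹ * ((√t)⁻¹ - (√(t + 1))⁻¹) := by
    intro t ht hst
    have h1 : 0 < √(t + 1) := Real.sqrt_pos.2 (by positivity)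
    have h0 : 0 < √t := Real.sqrt_pos.2 ht
    have e1 : √(t + 1) ^ 2 = t + 1 := Real.sq_sqrt (by positivity)
    have e0 : √t ^ 2 = t := Real.sq_sqrt ht.le
    have hle : √t ≤ √(t + 1) := Real.sqrt_le_sqrt (by linarith)
    have h2 : ((t + 1) * √(t + 1))⁻¹ ≤ 2 * ((√t)⁻¹ - (√(t + 1))⁻¹) := by
      have e : (√t)⁻¹ - (√(t + 1))⁻¹ = (√t * √(t + 1) * (√t + √(t + 1)))⁻¹ := by
        field_simp
        nlinarith
      rw [e, ← inv_inv (2 : ℝ), ← mul_inv]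
      refine inv_anti₀ (by positivity) ?_
      nlinarith [mul_le_mul hle hle h0.le h1.le, mul_pos h0 h1]
    have h3 : ((t + 1) ^ k)⁻¹ ≤ ((s : ℝ) ^ k)⁻¹ := by
      have : (s : ℝ) ≤ t + 1 := by linarith
      gcongr
    calc ((t + 1) ^ (k + 1) * √(t + 1))⁻¹ = ((t + 1) ^ k)⁻¹ * ((t + 1) * √(t + 1))⁻¹ := by
          rw [pow_succ, mul_assoc, mul_inv]
      _ ≤ ((s : ℝ) ^ k)⁻¹ * (2 * ((√t)⁻¹ - (√(t + 1))⁻¹)) := by gcongr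
      _ = _ := by ring
  have key : ∑ q ∈ range n, (((q + s : ℕ) + 1 : ℝ) ^ (k + 1) * √((q + s : ℕ) + 1 : ℝ))⁻¹ ≤
      2 * ((s : ℝ) ^ k)⁻¹ * ((√s)⁻¹ - (√(n + s : ℕ))⁻¹) := by
    induction n with
    | zero => simp
    | succ n ih =>
      rw [sum_range_succ]
      have := hstep (n + s : ℕ) (by positivity) (by push_cast; linarith [n.cast_nonneg (α := ℝ)])
      rw [show ((n + 1 + s : ℕ) : ℝ) = (n + s : ℕ) + 1 by push_cast; ring]
      linarith
  refine key.trans ?_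
  rw [mul_inv, ← mul_assoc]
  refine mul_le_mul_of_nonneg_left ?_ (by positivity)
  have : 0 ≤ (√(n + s : ℕ))⁻¹ := by positivity
  linarith

lemma abs_integral_mul_le {β φ : ℝ → ℝ} {B Φ : ℝ} (hβ : ∀ u ∈ Set.Icc (0 : ℝ) 1, |β u| ≤ B)
    (hφ : ∀ u ∈ Set.Icc (0 : ℝ) 1, |φ u| ≤ Φ) :
    |∫ u in (0 : ℝ)..1, β u * φ u| ≤ B * Φ := by
  have h := norm_integral_le_of_norm_le_const (a := (0 : ℝ)) (b := 1) (C := B * Φ)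
    (f := fun u => β u * φ u) (fun u hu => by
      rw [Set.uIoc_of_le zero_le_one] at hu
      have hu := Set.Ioc_subset_Icc_self hu
      rw [norm_mul]
      exact mul_le_mul (hβ u hu) (hφ u hu) (abs_nonneg _) ((abs_nonneg _).trans (hβ u hu)))
  simpa using h

lemma continuousOn_leibniz (j ℓ p : ℕ) (x y : ℝ) :
    ContinuousOn (fun w => ∑ a ∈ range (p + 1), (p.choose a : ℝ) * powJet j x a w *
      gaussJet ℓ y (p - a) w) (Set.Ioo 0 x) := by
  refine continuousOn_finsetSum _ fun a _ => ?_
  refine (continuousOn_const.mul fun w hw => ?_).mul fun w hw => ?_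
  · exact (hasDerivAt_powJet j x a hw.2).continuousAt.continuousWithinAt
  · exact (hasDerivAt_gaussJet ℓ y (p - a) hw.1).continuousAt.continuousWithinAt

/-- The moments of `β` against `(q + 1 + u) ^ (-(k + 1/2))` on the unit interval. -/
noncomputable def powMoment (β : ℝ → ℝ) (k q : ℕ) : ℝ :=
  ∫ u in (0 : ℝ)..1, β u * (((q : ℝ) + 1 + u) ^ k * √((q : ℝ) + 1 + u))⁻¹

lemma abs_powMoment_le {β : ℝ → ℝ} {B : ℝ} (hβ : ∀ u ∈ Set.Icc (0 : ℝ) 1, |β u| ≤ B) (k q : ℕ) :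
    |powMoment β k q| ≤ B * (((q : ℝ) + 1) ^ k * √((q : ℝ) + 1))⁻¹ := by
  refine abs_integral_mul_le hβ fun u hu => ?_
  have hle : (q : ℝ) + 1 ≤ q + 1 + u := by linarith [hu.1]
  have hsq := Real.sqrt_le_sqrt hle
  have hpos : 0 < √((q : ℝ) + 1) := Real.sqrt_pos.2 (by positivity)
  have hu0 := hu.1
  rw [abs_of_nonneg (by positivity)]
  gcongr

lemma abs_tsum_powMoment_sub_le {β : ℝ → ℝ} {B : ℝ} (hβ : ∀ u ∈ Set.Icc (0 : ℝ) 1, |β u| ≤ B)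
    (k : ℕ) {s : ℕ} (hs : 0 < s) :
    |∑' q, powMoment β (k + 1) q - ∑ q ∈ range s, powMoment β (k + 1) q| ≤
      B * (2 * ((s : ℝ) ^ k * √s)⁻¹) := by
  have hB : 0 ≤ B := (abs_nonneg _).trans (hβ 0 (by simp))
  have hpart : ∀ n, ∑ q ∈ range n, |powMoment β (k + 1) (q + s)| ≤
      B * (2 * ((s : ℝ) ^ k * √s)⁻¹) := fun n => by
    refine (sum_le_sum fun q _ => abs_powMoment_le hβ (k + 1) (q + s)).trans ?_
    rw [← mul_sum]
    exact mul_le_mul_of_nonneg_left (sum_shift_inv_le k s hs n) hB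
  have habs : Summable fun q => |powMoment β (k + 1) (q + s)| :=
    summable_of_sum_range_le (fun _ => abs_nonneg _) hpart
  have hsum : Summable (powMoment β (k + 1)) :=
    (summable_nat_add_iff s).1 (summable_abs_iff.1 habs)
  rw [← hsum.sum_add_tsum_nat_add s, add_sub_cancel_left]
  have h := norm_tsum_le_tsum_norm (f := fun q => powMoment β (k + 1) (q + s)) habs
  exact h.trans (habs.tsum_le_of_sum_range_le hpart)

lemma abs_integral_leibniz_sub_le (j ℓ p : ℕ) {β : ℝ → ℝ} (hcont : Continuous β) {B y K : ℝ}
    (hβ : ∀ u ∈ Set.Icc (0 : ℝ) 1, |β u| ≤ B)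
    (hK : ∀ w : ℝ, 0 < w → |gaussJet ℓ y (j + p) w| ≤ K * (√w)⁻¹) {s q : ℕ} (hq : q < s) :
    |(∫ u in (0 : ℝ)..1, β u * ∑ a ∈ range (p + 1), (p.choose a : ℝ) *
        powJet j (s + 2) a (s + 2 - (q + 1 + u)) * gaussJet ℓ y (p - a) (s + 2 - (q + 1 + u))) -
      ∑ i ∈ range (j + p), gaussJet ℓ y i (s + 2) * expansionCoeff j p i *
        powMoment β (j + p - i) q| ≤
      B * ((∑ a ∈ range (p + 1), (p.choose a : ℝ) *
        (ascPochhammer ℝ a).eval ((j : ℝ) + 1 / 2)) * K *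
          ((√((q : ℝ) + 1))⁻¹ * (√((s : ℝ) - q))⁻¹)) := by
  have hqs : (q : ℝ) + 1 ≤ s := by exact_mod_cast hq
  have hq0 : (0 : ℝ) ≤ q := q.cast_nonneg
  have hK0 : 0 ≤ K := by simpa using (abs_nonneg _).trans (hK 1 one_pos)
  have hcF : ContinuousOn (fun u : ℝ => ∑ a ∈ range (p + 1), (p.choose a : ℝ) *
      powJet j (s + 2) a (s + 2 - (q + 1 + u)) * gaussJet ℓ y (p - a) (s + 2 - (q + 1 + u)))
      (Set.uIcc 0 1) := by
    refine (continuousOn_leibniz j ℓ p (s + 2) y).comp (f := fun u : ℝ => (s : ℝ) + 2 - (q + 1 + u))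
      (by fun_prop) fun u hu => ?_
    rw [Set.uIcc_of_le zero_le_one] at hu
    exact ⟨by linarith [hu.2], by linarith [hu.1]⟩
  have hcm : ∀ k : ℕ, ContinuousOn (fun u : ℝ => β u *
      (((q : ℝ) + 1 + u) ^ k * √((q : ℝ) + 1 + u))⁻¹) (Set.uIcc 0 1) := fun k => by
    refine hcont.continuousOn.mul (ContinuousOn.inv₀ (by fun_prop) fun u hu => ?_)
    rw [Set.uIcc_of_le zero_le_one] at hu
    have h : 0 < (q : ℝ) + 1 + u := by linarith [hu.1]
    exact (mul_pos (pow_pos h k) (Real.sqrt_pos.2 h)).ne'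
  simp only [powMoment, ← intervalIntegral.integral_const_mul]
  rw [← intervalIntegral.integral_finsetSum fun i _ => ((hcm (j + p - i)).intervalIntegrable).const_mul _,
    ← intervalIntegral.integral_sub (hcont.continuousOn.fun_mul hcF).intervalIntegrable
      (continuousOn_finsetSum _ fun i _ =>
        continuousOn_const.fun_mul (hcm (j + p - i))).intervalIntegrable]
  rw [show (∫ u in (0 : ℝ)..1, (β u * ∑ a ∈ range (p + 1), (p.choose a : ℝ) *
        powJet j (s + 2) a (s + 2 - (q + 1 + u)) * gaussJet ℓ y (p - a) (s + 2 - (q + 1 + u)) -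
      ∑ i ∈ range (j + p), gaussJet ℓ y i (s + 2) * expansionCoeff j p i *
        (β u * (((q : ℝ) + 1 + u) ^ (j + p - i) * √((q : ℝ) + 1 + u))⁻¹))) =
      ∫ u in (0 : ℝ)..1, β u * (∑ a ∈ range (p + 1), (p.choose a : ℝ) *
        powJet j (s + 2) a (s + 2 - (q + 1 + u)) * gaussJet ℓ y (p - a) (s + 2 - (q + 1 + u)) -
      ∑ i ∈ range (j + p), gaussJet ℓ y i (s + 2) * expansionCoeff j p i *
        (((q : ℝ) + 1 + u) ^ (j + p - i) * √((q : ℝ) + 1 + u))⁻¹) from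
    integral_congr fun u _ => by
      simp only [mul_sub, mul_sum]
      congr 1
      exact sum_congr rfl fun i _ => by ring]
  refine abs_integral_mul_le hβ fun u hu => ?_
  refine (leibniz_expansion_bound j ℓ p hK (by linarith [hu.1]) (by linarith [hu.2])).trans ?_
  have h1 : √((q : ℝ) + 1) ≤ √((q : ℝ) + 1 + u) := Real.sqrt_le_sqrt (by linarith [hu.1])
  have h2 : √((s : ℝ) - q) ≤ √((s : ℝ) + 2 - (q + 1 + u)) := Real.sqrt_le_sqrt (by linarith [hu.2])
  have h1' : 0 < √((q : ℝ) + 1) := Real.sqrt_pos.2 (by linarith)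
  have h2' : 0 < √((s : ℝ) - q) := Real.sqrt_pos.2 (by linarith)
  have hL : 0 ≤ ∑ a ∈ range (p + 1), (p.choose a : ℝ) *
      (ascPochhammer ℝ a).eval ((j : ℝ) + 1 / 2) :=
    sum_nonneg fun a _ => mul_nonneg (Nat.cast_nonneg _)
      (ascPochhammer_pos a _ (by positivity)).le
  gcongr

lemma exists_gaussJet_mul_tail_le (j ℓ p i : ℕ) (hi : i < j + p) :
    ∃ C : ℝ, 0 < C ∧ ∀ y : ℝ, 0 ≤ y → ∀ s : ℕ, 0 < s →
      y ^ (j + ℓ + p) * |gaussJet ℓ y i (s + 2)| * ((s : ℝ) ^ (j + p - i - 1) * √s)⁻¹ ≤ C := by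
  obtain ⟨C, hC, h⟩ := exists_gaussJet_bound ℓ i (j + ℓ + p)
  obtain ⟨k, hk⟩ : ∃ k, j + p - i = k + 1 := ⟨j + p - i - 1, by omega⟩
  refine ⟨C * 3 ^ (k + 1), by positivity, fun y hy s hs => ?_⟩
  have hs1 : (1 : ℝ) ≤ s := by exact_mod_cast hs
  have hs0 : (0 : ℝ) < s := by linarith
  have hx0 : (0 : ℝ) < s + 2 := by linarith
  rw [hk, add_tsub_cancel_right]
  refine (mul_le_mul_of_nonneg_right (h y hy (s + 2) hx0) (by positivity)).trans ?_
  rw [show (ℓ : ℝ) + 1 / 2 + i = ((ℓ + i : ℕ) : ℝ) + 1 / 2 by push_cast; ring,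
    rpow_neg_add_half hx0, mul_assoc]
  refine mul_le_mul_of_nonneg_left ?_ hC.le
  have hsq : 0 < √(s : ℝ) := Real.sqrt_pos.2 hs0
  have hle : √(s : ℝ) ≤ √((s : ℝ) + 2) := Real.sqrt_le_sqrt (by linarith)
  have hss : √(s : ℝ) * √s = s := Real.mul_self_sqrt hs0.le
  have hpow : ((s : ℝ) + 2) ^ (j + ℓ + p) = (s + 2) ^ (ℓ + i) * (s + 2) ^ (k + 1) := by
    rw [← pow_add]; congr 1; omega
  calc ((s : ℝ) + 2) ^ (j + ℓ + p) * ((s + 2) ^ (ℓ + i) * √((s : ℝ) + 2))⁻¹ *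
        ((s : ℝ) ^ k * √s)⁻¹
      = ((s : ℝ) + 2) ^ (k + 1) * (√((s : ℝ) + 2) * (s ^ k * √s))⁻¹ := by
        rw [hpow]; field_simp
    _ ≤ (3 * (s : ℝ)) ^ (k + 1) * (√s * (s ^ k * √s))⁻¹ := by
        have : (s : ℝ) + 2 ≤ 3 * s := by linarith
        gcongr
    _ = 3 ^ (k + 1) := by
        rw [show √(s : ℝ) * (s ^ k * √s) = s ^ (k + 1) by
          rw [mul_left_comm, hss, pow_succ], mul_pow]
        field_simp

lemma exists_leibniz_sum_bound (j ℓ p : ℕ) {β : ℝ → ℝ} (hcont : Continuous β) :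
    ∃ (κ : ℕ → ℝ) (C : ℝ), 0 < C ∧ ∀ s : ℕ, 0 < s → ∀ y : ℝ, 0 < y →
      y ^ (j + ℓ + p) * |∑ q ∈ range s, (∫ u in (0 : ℝ)..1, β u * ∑ a ∈ range (p + 1),
          (p.choose a : ℝ) * powJet j (s + 2) a (s + 2 - (q + 1 + u)) *
            gaussJet ℓ y (p - a) (s + 2 - (q + 1 + u))) -
        ∑ i ∈ range (j + p), gaussJet ℓ y i (s + 2) * κ i| ≤ C := by
  obtain ⟨B, hβ⟩ := isCompact_Icc.exists_bound_of_continuousOn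
    (hcont.continuousOn (s := Set.Icc (0 : ℝ) 1))
  have hB : 0 ≤ B := (norm_nonneg _).trans (hβ 0 (by simp))
  obtain ⟨D, hD, hjet⟩ := exists_gaussJet_bound ℓ (j + p) (j + ℓ + p)
  choose! T hT htail using exists_gaussJet_mul_tail_le j ℓ p
  set L : ℝ := ∑ a ∈ range (p + 1), (p.choose a : ℝ) * (ascPochhammer ℝ a).eval ((j : ℝ) + 1 / 2)
  have hL : 0 ≤ L := sum_nonneg fun a _ => mul_nonneg (Nat.cast_nonneg _)
      (ascPochhammer_pos a _ (by positivity)).le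
  have hTsum : 0 ≤ ∑ i ∈ range (j + p), |expansionCoeff j p i| * (2 * B) * T i :=
    sum_nonneg fun i hi => by
      have := hT i (mem_range.1 hi)
      positivity
  refine ⟨fun i => expansionCoeff j p i * ∑' q, powMoment β (j + p - i) q,
    B * (L * D) * 4 + ∑ i ∈ range (j + p), |expansionCoeff j p i| * (2 * B) * T i + 1,
    by positivity, fun s hs y hy => ?_⟩
  have hyM : 0 < y ^ (j + ℓ + p) := by positivity
  have hK : ∀ w : ℝ, 0 < w → |gaussJet ℓ y (j + p) w| ≤ D / y ^ (j + ℓ + p) * (√w)⁻¹ := by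
    intro w hw
    have h := hjet y hy.le w hw
    rw [show (ℓ : ℝ) + 1 / 2 + (j + p : ℕ) = ((j + ℓ + p : ℕ) : ℝ) + 1 / 2 by push_cast; ring,
      rpow_neg_add_half hw, mul_inv, mul_inv_cancel_left₀ (by positivity)] at h
    rw [div_mul_eq_mul_div, le_div_iff₀ hyM, mul_comm]
    exact h
  set I : ℕ → ℝ := fun q => ∫ u in (0 : ℝ)..1, β u * ∑ a ∈ range (p + 1),
          (p.choose a : ℝ) * powJet j (s + 2) a (s + 2 - (q + 1 + u)) *
            gaussJet ℓ y (p - a) (s + 2 - (q + 1 + u))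
  set J : ℕ → ℝ := fun i => gaussJet ℓ y i (s + 2)
  set c : ℕ → ℝ := expansionCoeff j p
  have hsplit : ∑ q ∈ range s, I q -
        ∑ i ∈ range (j + p), J i * (c i * ∑' q, powMoment β (j + p - i) q) =
      ∑ q ∈ range s, (I q - ∑ i ∈ range (j + p), J i * c i * powMoment β (j + p - i) q) -
        ∑ i ∈ range (j + p), J i * c i * (∑' q, powMoment β (j + p - i) q -
          ∑ q ∈ range s, powMoment β (j + p - i) q) := by
    rw [sum_sub_distrib, sum_comm]
    simp only [mul_sub, sum_sub_distrib, mul_sum, mul_assoc]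
    ring
  have hfirst : y ^ (j + ℓ + p) *
      |∑ q ∈ range s, (I q - ∑ i ∈ range (j + p), J i * c i * powMoment β (j + p - i) q)| ≤
      B * (L * D) * 4 := by
    have h1 := (abs_sum_le_sum_abs _ _).trans (sum_le_sum fun q (hq : q ∈ range s) =>
      abs_integral_leibniz_sub_le j ℓ p hcont hβ hK (mem_range.1 hq))
    rw [← mul_sum, ← mul_sum] at h1
    refine (mul_le_mul_of_nonneg_left h1 hyM.le).trans ?_
    have h2 := sum_inv_sqrt_mul_inv_sqrt_le s
    calc _ = B * (L * D) * ∑ q ∈ range s, (√((q : ℝ) + 1))⁻¹ * (√((s : ℝ) - q))⁻¹ := by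
          simp only [L]; field_simp
      _ ≤ _ := by gcongr
  have hsecond : y ^ (j + ℓ + p) * |∑ i ∈ range (j + p), J i * c i *
      (∑' q, powMoment β (j + p - i) q - ∑ q ∈ range s, powMoment β (j + p - i) q)| ≤
      ∑ i ∈ range (j + p), |c i| * (2 * B) * T i := by
    refine (mul_le_mul_of_nonneg_left (abs_sum_le_sum_abs _ _) hyM.le).trans ?_
    rw [mul_sum]
    refine sum_le_sum fun i hi => ?_
    have hi := mem_range.1 hi
    have h1 := htail i hi y hy.le s hs
    have h2 := abs_tsum_powMoment_sub_le hβ (j + p - i - 1) hs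
    rw [show j + p - i - 1 + 1 = j + p - i by omega] at h2
    rw [abs_mul, abs_mul]
    calc _ ≤ y ^ (j + ℓ + p) * (|J i| * |c i| *
          (B * (2 * ((s : ℝ) ^ (j + p - i - 1) * √s)⁻¹))) := by gcongr
      _ = |c i| * (2 * B) *
          (y ^ (j + ℓ + p) * |J i| * ((s : ℝ) ^ (j + p - i - 1) * √s)⁻¹) := by ring
      _ ≤ _ := by gcongr
  rw [hsplit]
  refine (mul_le_mul_of_nonneg_left (abs_sub _ _) hyM.le).trans ?_
  rw [mul_add]
  linarith

/-- Lemma 8: estimate for the remainder term in the Euler–Maclaurin formula. -/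
theorem stmt_13 (j ℓ m p : ℕ) (hm : m ≤ 2 * (j + ℓ + p)) :
    ∃ (P : ℕ → Polynomial ℝ) (C : ℝ), 0 < C ∧
      (∀ i, (P i).natDegree ≤ i) ∧
      ∀ n : ℕ, 4 ≤ n → ∀ z : ℝ, z ≠ 0 →
        |(∫ u in (0 : ℝ)..1,
            (((Polynomial.bernoulli p).map (algebraMap ℚ ℝ)).eval u
                - ((bernoulli p : ℚ) : ℝ)) *
              ∑ k ∈ Finset.Icc 1 (n - 2),
                iteratedDeriv p
                  (fun w : ℝ =>
                    z ^ m * ((n : ℝ) - w) ^ (-((j : ℝ) + 1 / 2)) *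
                      w ^ (-((ℓ : ℝ) + 1 / 2)) * Real.exp (-z ^ 2 / (2 * w)))
                  ((k : ℝ) + 1 - u))
          - Real.exp (-z ^ 2 / (2 * n)) * (z ^ m / (n : ℝ) ^ ((ℓ : ℝ) + 1 / 2)) *
              ∑ i ∈ Finset.range (j + p), (P i).eval (z ^ 2 / n) * ((n : ℝ) ^ i)⁻¹|
        ≤ C / min ((n : ℝ) ^ ((j : ℝ) + ℓ + p - (m : ℝ) / 2))
              (|z| ^ (2 * (j + ℓ + p) - m)) := by
  set β : ℝ → ℝ := fun u => ((Polynomial.bernoulli p).map (algebraMap ℚ ℝ)).eval u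
                - ((bernoulli p : ℚ) : ℝ)
  have hcont : Continuous β := (Polynomial.continuous _).sub continuous_const
  obtain ⟨κ, C, hC, hbound⟩ := exists_leibniz_sum_bound j ℓ p hcont
  refine ⟨fun i => Polynomial.C (κ i) * gaussPoly ℓ i, C, hC, fun i =>
    (Polynomial.natDegree_C_mul_le _ _).trans (natDegree_gaussPoly_le ℓ i), fun n hn z hz => ?_⟩
  obtain ⟨s, rfl⟩ : ∃ s, n = s + 2 := ⟨n - 2, by omega⟩
  have hs : 0 < s := by omega
  have hy : 0 < z ^ 2 := by positivity
  have hb := hbound s hs (z ^ 2) hy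
  have hx : (0 : ℝ) < s + 2 := by positivity
  have hmain : Real.exp (-z ^ 2 / (2 * (s + 2 : ℕ))) *
      (z ^ m / ((s + 2 : ℕ) : ℝ) ^ ((ℓ : ℝ) + 1 / 2)) *
      ∑ i ∈ range (j + p), (Polynomial.C (κ i) * gaussPoly ℓ i).eval (z ^ 2 / (s + 2 : ℕ)) *
        (((s + 2 : ℕ) : ℝ) ^ i)⁻¹ =
      z ^ m * ∑ i ∈ range (j + p), gaussJet ℓ (z ^ 2) i (s + 2) * κ i := by
    push_cast
    rw [mul_sum, mul_sum]
    refine sum_congr rfl fun i _ => ?_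
    rw [gaussJet, Real.rpow_neg hx.le, Real.rpow_add_natCast hx.ne', Polynomial.eval_mul,
      Polynomial.eval_C]
    field_simp
  have hint : (∫ u in (0 : ℝ)..1, β u * ∑ k ∈ Finset.Icc 1 s, iteratedDeriv p
      (fun w : ℝ => z ^ m * (((s + 2 : ℕ) : ℝ) - w) ^ (-((j : ℝ) + 1 / 2)) *
        w ^ (-((ℓ : ℝ) + 1 / 2)) * Real.exp (-z ^ 2 / (2 * w))) ((k : ℝ) + 1 - u)) =
      z ^ m * ∑ q ∈ range s, (∫ u in (0 : ℝ)..1, β u * ∑ a ∈ range (p + 1),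
          (p.choose a : ℝ) * powJet j (s + 2) a (s + 2 - (q + 1 + u)) *
            gaussJet ℓ (z ^ 2) (p - a) (s + 2 - (q + 1 + u))) := by
    rw [← intervalIntegral.integral_finsetSum, ← intervalIntegral.integral_const_mul]
    · refine integral_congr fun u hu => ?_
      rw [Set.uIcc_of_le zero_le_one] at hu
      rw [← mul_sum, mul_left_comm]
      congr 1
      rw [mul_sum, ← Finset.Ico_add_one_right_eq_Icc, sum_Ico_eq_sum_range, ← sum_range_reflect,
        add_tsub_cancel_right]
      refine sum_congr rfl fun q hq => ?_
      have hq := mem_range.1 hq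
      have hq' : (q : ℝ) + 1 ≤ s := by exact_mod_cast hq
      have hcast : ((1 + (s - 1 - q) : ℕ) : ℝ) + 1 - u = s + 2 - (q + 1 + u) := by
        rw [show 1 + (s - 1 - q) = s - q by omega, Nat.cast_sub hq.le]
        ring
      have hq0 : (0 : ℝ) ≤ q := q.cast_nonneg
      rw [hcast]
      push_cast
      exact iteratedDeriv_pow_mul_gauss j ℓ m p (s + 2) z (by linarith [hu.2])
        (by linarith [hu.1])
    · intro q hq
      have hq' : (q : ℝ) + 1 ≤ s := by exact_mod_cast mem_range.1 hq
      have hq0 : (0 : ℝ) ≤ q := q.cast_nonneg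
      refine (hcont.continuousOn.mul ((continuousOn_leibniz j ℓ p (s + 2) (z ^ 2)).comp
        (f := fun u : ℝ => (s : ℝ) + 2 - (q + 1 + u)) (by fun_prop)
        fun u hu => ?_)).intervalIntegrable
      rw [Set.uIcc_of_le zero_le_one] at hu
      exact ⟨by linarith [hu.2], by linarith [hu.1]⟩
  rw [add_tsub_cancel_right, hint, hmain, ← mul_sub, abs_mul, abs_pow]
  have hz0 : 0 < |z| := abs_pos.2 hz
  have hzpow : (z ^ 2) ^ (j + ℓ + p) = |z| ^ (2 * (j + ℓ + p) - m) * |z| ^ m := by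
    rw [← pow_add, Nat.sub_add_cancel hm, pow_mul, sq_abs]
  rw [hzpow, mul_assoc] at hb
  have hmin : 0 < min (((s + 2 : ℕ) : ℝ) ^ ((j : ℝ) + ℓ + p - (m : ℝ) / 2))
      (|z| ^ (2 * (j + ℓ + p) - m)) :=
    lt_min (Real.rpow_pos_of_pos (by positivity) _) (by positivity)
  rw [le_div_iff₀ hmin, mul_comm]
  exact (mul_le_mul_of_nonneg_right (min_le_right _ _) (by positivity)).trans hb
end

section
/- Let r ≥ 1 be an integer and let j, q, s, ν, μ be nonnegative integers with s ≤ q ≤ 2j and s + ν + 2μ ≤ r. Let (v_k)_{k≥2} be real numbers satisfying |v_k| ≤ C₀ (log k)^{⌊(r−s−ν−2μ)/2⌋} / k^{(r−s−ν−2μ)/2+2} for all k ≥ 2 and some C₀ > 0. Then there exist polynomials H₀, …, H_{⌊(r+3)/2⌋} with real coefficients, where H_η has degree at most η, and a constant C > 0 such that for all integers n ≥ 4 and all reals z, |z^{q−s+ν} · Σ_{k=2}^{n−1} v_k · (n−k)^{−(j+ν+μ+1/2)} · e^{−z²/(2(n−k))} − (z^{q−s+ν}/n^{j+ν+μ+1/2})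 · e^{−z²/(2n)} · Σ_{η=0}^{⌊(r+3)/2⌋} H_η(z²/n) · n^{−η}| ≤ C / (min(√n, 1+|z|))^{r+2}. -/
open Finset Real

/-- The kernel `t ↦ (1 - t) ^ (-α) * exp (-y / (2 * (1 - t)))`; up to the factor `exp (-y / 2)` it is
the generating function of Laguerre polynomials. -/
noncomputable def laguerreKernel (α y t : ℝ) : ℝ :=
  (1 - t) ^ (-α) * exp (-y / (2 * (1 - t)))

/-- The Taylor coefficients at `0` of `t ↦ exp (y / 2) * laguerreKernel α y t`, as polynomials
in `y`. -/
noncomputable def laguerreCoeff : ℕ → ℝ → Polynomial ℝ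
  | 0, _ => 1
  | η + 1, α => Polynomial.C (α / ((η : ℝ) + 1)) * laguerreCoeff η (α + 1) -
      Polynomial.C (1 / (2 * ((η : ℝ) + 1))) * (Polynomial.X * laguerreCoeff η (α + 2))

theorem natDegree_laguerreCoeff_le (η : ℕ) (α : ℝ) : (laguerreCoeff η α).natDegree ≤ η := by
  induction η generalizing α with
  | zero => simp [laguerreCoeff]
  | succ η ih =>
    rw [laguerreCoeff]
    refine (Polynomial.natDegree_sub_le _ _).trans (max_le ?_ ?_)
    · exact (Polynomial.natDegree_C_mul_le _ _).trans ((ih _).trans η.le_succ)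
    · refine (Polynomial.natDegree_C_mul_le _ _).trans (Polynomial.natDegree_mul_le.trans ?_)
      have := ih (α + 2)
      have := Polynomial.natDegree_X_le (R := ℝ)
      omega

theorem hasDerivAt_laguerreKernel (α y : ℝ) {t : ℝ} (ht : t < 1) :
    HasDerivAt (laguerreKernel α y)
      (α * laguerreKernel (α + 1) y t - y / 2 * laguerreKernel (α + 2) y t) t := by
  have h1 : 0 < 1 - t := by linarith
  have hlin : HasDerivAt (fun t : ℝ => 1 - t) (-1) t := by
    simpa using (hasDerivAt_id t).const_sub 1
  have hpow := hlin.rpow_const (p := -α) (Or.inl h1.ne')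
  have hexp := ((hasDerivAt_const t (-y)).div (hlin.const_mul 2) (by positivity)).exp
  refine (hpow.mul hexp).congr_deriv ?_
  have e1 : (1 - t) ^ (-(α + 1)) = (1 - t) ^ (-α) / (1 - t) := by
    rw [neg_add, rpow_add h1, rpow_neg_one, div_eq_mul_inv]
  have e2 : (1 - t) ^ (-(α + 2)) = (1 - t) ^ (-α) / (1 - t) ^ 2 := by
    rw [neg_add, rpow_add h1, rpow_neg h1.le 2, div_eq_mul_inv]
    norm_cast
  have e3 : (1 - t) ^ (-α - 1) = (1 - t) ^ (-α) / (1 - t) := by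
    rw [rpow_sub_one h1.ne']
  simp only [laguerreKernel, e1, e2, e3, Pi.div_apply]
  field_simp
  ring

theorem laguerreKernel_zero (α y : ℝ) : laguerreKernel α y 0 = exp (-y / 2) := by
  simp [laguerreKernel]

theorem hasDerivAt_sum_laguerreCoeff (N : ℕ) (α y t : ℝ) :
    HasDerivAt (fun t => ∑ η ∈ range (N + 1), (laguerreCoeff η α).eval y * t ^ η)
      (α * (∑ η ∈ range N, (laguerreCoeff η (α + 1)).eval y * t ^ η) -
        y / 2 * ∑ η ∈ range N, (laguerreCoeff η (α + 2)).eval y * t ^ η) t := by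
  have h : ∀ η ∈ range (N + 1), HasDerivAt (fun t => (laguerreCoeff η α).eval y * t ^ η)
      ((laguerreCoeff η α).eval y * (η * t ^ (η - 1))) t := fun η _ =>
    (hasDerivAt_pow η t).const_mul _
  refine (HasDerivAt.fun_sum h).congr_deriv ?_
  rw [sum_range_succ', mul_sum, mul_sum, ← sum_sub_distrib]
  simp only [Nat.cast_zero, zero_mul, mul_zero, add_zero]
  refine sum_congr rfl fun η _ => ?_
  have : (η : ℝ) + 1 ≠ 0 := by positivity
  simp only [laguerreCoeff, Polynomial.eval_sub, Polynomial.eval_mul, Polynomial.eval_C,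
    Polynomial.eval_X, Nat.add_sub_cancel, Nat.cast_add, Nat.cast_one]
  field_simp

/-- Taylor expansion of the kernel, with a remainder that is uniform in `y`. -/
theorem exists_laguerreKernel_sub_sum_le (N : ℕ) (α : ℝ) (hα : 0 ≤ α) :
    ∃ C, 0 ≤ C ∧ ∀ y t : ℝ, 0 ≤ y → 0 ≤ t → t ≤ 1 / 2 →
      |laguerreKernel α y t -
          exp (-y / 2) * ∑ η ∈ range N, (laguerreCoeff η α).eval y * t ^ η| ≤
        C * t ^ N * (1 + y) ^ N * exp (-y / 2) := by
  induction N generalizing α with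
  | zero =>
    refine ⟨2 ^ α, by positivity, fun y t hy ht ht' => ?_⟩
    have h1 : 0 < 1 - t := by linarith
    simp only [range_zero, sum_empty, mul_zero, sub_zero, pow_zero, mul_one, laguerreKernel]
    rw [abs_of_nonneg (by positivity)]
    refine mul_le_mul ?_ (exp_le_exp.2 ?_) (by positivity) (by positivity)
    · rw [rpow_neg h1.le, ← inv_rpow h1.le]
      refine rpow_le_rpow (by positivity) ?_ hα
      rw [inv_le_comm₀ h1 two_pos]
      linarith
    · rw [neg_div, neg_div, neg_le_neg_iff]
      exact div_le_div_of_nonneg_left hy (by positivity) (by linarith)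
  | succ N ih =>
    obtain ⟨C₁, hC₁, h₁⟩ := ih (α + 1) (by positivity)
    obtain ⟨C₂, hC₂, h₂⟩ := ih (α + 2) (by positivity)
    refine ⟨α * C₁ + C₂, by positivity, fun y t hy ht ht' => ?_⟩
    set D : ℝ → ℝ := fun t => laguerreKernel α y t -
      exp (-y / 2) * ∑ η ∈ range (N + 1), (laguerreCoeff η α).eval y * t ^ η with hD
    have hderiv : ∀ x ∈ Set.Icc 0 t, HasDerivWithinAt D _ (Set.Icc 0 t) x := fun x hx =>
      ((hasDerivAt_laguerreKernel α y (by linarith [hx.2])).sub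
        ((hasDerivAt_sum_laguerreCoeff N α y x).const_mul (exp (-y / 2)))).hasDerivWithinAt
    have hbound := Convex.norm_image_sub_le_of_norm_hasDerivWithin_le
      (C := (α * C₁ + C₂) * t ^ N * (1 + y) ^ (N + 1) * exp (-y / 2)) hderiv ?_
      (convex_Icc 0 t) (Set.left_mem_Icc.2 ht) (Set.right_mem_Icc.2 ht)
    · have hD0 : D 0 = 0 := by
        simp [hD, laguerreKernel_zero, sum_range_succ', laguerreCoeff]
      rw [hD0, sub_zero, sub_zero, norm_eq_abs, norm_eq_abs, abs_of_nonneg ht] at hbound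
      refine hbound.trans (le_of_eq ?_)
      ring
    · intro x hx
      have hx0 := hx.1
      have hmono : x ^ N ≤ t ^ N := pow_le_pow_left₀ hx.1 hx.2 N
      have b₁ := h₁ y x hy hx.1 (hx.2.trans ht')
      have b₂ := h₂ y x hy hx.1 (hx.2.trans ht')
      set R₁ := laguerreKernel (α + 1) y x -
        exp (-y / 2) * ∑ η ∈ range N, (laguerreCoeff η (α + 1)).eval y * x ^ η
      set R₂ := laguerreKernel (α + 2) y x -
        exp (-y / 2) * ∑ η ∈ range N, (laguerreCoeff η (α + 2)).eval y * x ^ η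
      calc ‖_‖ = |α * R₁ - y / 2 * R₂| := by rw [norm_eq_abs]; congr 1; ring
        _ ≤ α * |R₁| + y / 2 * |R₂| := by
          refine (abs_sub _ _).trans ?_
          rw [abs_mul, abs_mul, abs_of_nonneg hα, abs_of_nonneg (by positivity : 0 ≤ y / 2)]
        _ ≤ (1 + y) * α * (C₁ * t ^ N * (1 + y) ^ N * exp (-y / 2)) +
            (1 + y) * (C₂ * t ^ N * (1 + y) ^ N * exp (-y / 2)) := by
          gcongr
          · nlinarith
          · exact b₁.trans (by gcongr)
          · linarith
          · exact b₂.trans (by gcongr)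
        _ = _ := by ring

theorem Polynomial.exists_abs_eval_le {P : Polynomial ℝ} {d : ℕ} (hP : P.natDegree ≤ d) :
    ∃ C, 0 ≤ C ∧ ∀ y : ℝ, 0 ≤ y → |P.eval y| ≤ C * (1 + y) ^ d := by
  refine ⟨∑ i ∈ range (d + 1), |P.coeff i|, by positivity, fun y hy => ?_⟩
  rw [Polynomial.eval_eq_sum_range' (Nat.lt_succ_of_le hP), sum_mul]
  refine (abs_sum_le_sum_abs _ _).trans (sum_le_sum fun i hi => ?_)
  rw [abs_mul, abs_of_nonneg (pow_nonneg hy i)]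
  gcongr
  calc y ^ i ≤ (1 + y) ^ i := by gcongr; linarith
    _ ≤ (1 + y) ^ d := pow_le_pow_right₀ (by linarith) (by simpa [Nat.lt_succ_iff] using hi)

/-- The kernel cut off at `1 / 2` agrees with its Taylor polynomial of degree `L` up to a term of
order `x ^ A`, for every real exponent `A` between `L` and `L + 1` and all `x > 0`. -/
theorem exists_truncated_laguerreKernel_sub_sum_le (L : ℕ) (A α : ℝ) (hα : 0 ≤ α)
    (hLA : (L : ℝ) ≤ A) (hAL : A ≤ L + 1) :
    ∃ C, 0 ≤ C ∧ ∀ y x : ℝ, 0 ≤ y → 0 < x →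
      |(if x ≤ 1 / 2 then laguerreKernel α y x else 0) -
          exp (-y / 2) * ∑ η ∈ range (L + 1), (laguerreCoeff η α).eval y * x ^ η| ≤
        C * x ^ A * ((1 + y) ^ (L + 1) * exp (-y / 2)) := by
  obtain ⟨C₁, hC₁, h₁⟩ := exists_laguerreKernel_sub_sum_le (L + 1) α hα
  choose c hc hcb using fun η =>
    Polynomial.exists_abs_eval_le (natDegree_laguerreCoeff_le η α)
  have hS : 0 ≤ ∑ η ∈ range (L + 1), c η := sum_nonneg fun η _ => hc η
  refine ⟨C₁ + (∑ η ∈ range (L + 1), c η) * 2 ^ A, by positivity, fun y x hy hx => ?_⟩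
  split_ifs with hx2
  · refine (h₁ y x hy hx.le hx2).trans ?_
    have hpow : x ^ (L + 1) ≤ x ^ A := by
      rw [← rpow_natCast]
      exact rpow_le_rpow_of_exponent_ge hx (by linarith) (by push_cast; exact hAL)
    rw [mul_assoc]
    gcongr
    exact le_add_of_nonneg_right (by positivity)
  · rw [zero_sub, abs_neg, abs_mul, abs_of_pos (exp_pos _)]
    have hsum : |∑ η ∈ range (L + 1), (laguerreCoeff η α).eval y * x ^ η| ≤
        (∑ η ∈ range (L + 1), c η) * 2 ^ A * x ^ A * (1 + y) ^ (L + 1) := by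
      rw [sum_mul, sum_mul, sum_mul]
      refine (abs_sum_le_sum_abs _ _).trans (sum_le_sum fun η hη => ?_)
      have hηL : η ≤ L := by simpa [Nat.lt_succ_iff] using hη
      rw [abs_mul, abs_of_nonneg (by positivity : 0 ≤ x ^ η)]
      have hpow : x ^ η ≤ 2 ^ A * x ^ A := by
        rw [← mul_rpow zero_le_two hx.le]
        calc x ^ η ≤ (2 * x) ^ η := by gcongr; linarith
          _ = (2 * x) ^ (η : ℝ) := (rpow_natCast _ _).symm
          _ ≤ (2 * x) ^ A := by
            refine rpow_le_rpow_of_exponent_le (by linarith) (le_trans ?_ hLA)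
            exact_mod_cast hηL
      calc |(laguerreCoeff η α).eval y| * x ^ η
          ≤ (c η * (1 + y) ^ (L + 1)) * (2 ^ A * x ^ A) := by
            refine mul_le_mul ((hcb η y hy).trans ?_) hpow (by positivity)
              (mul_nonneg (hc η) (by positivity))
            exact mul_le_mul_of_nonneg_left
              (pow_le_pow_right₀ (by linarith) (by omega)) (hc η)
        _ = _ := by ring
    calc exp (-y / 2) * |∑ η ∈ range (L + 1), (laguerreCoeff η α).eval y * x ^ η|
        ≤ exp (-y / 2) * ((∑ η ∈ range (L + 1), c η) * 2 ^ A * x ^ A * (1 + y) ^ (L + 1)) := by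
          gcongr
      _ = ((∑ η ∈ range (L + 1), c η) * 2 ^ A) * x ^ A * ((1 + y) ^ (L + 1) * exp (-y / 2)) := by
          ring
      _ ≤ _ := by
          gcongr
          exact le_add_of_nonneg_left hC₁

theorem one_add_pow_mul_exp_neg_sq_le (K : ℕ) {u : ℝ} (hu : 0 ≤ u) :
    (1 + u) ^ K * exp (-u ^ 2 / 2) ≤ K.factorial * exp (3 / 2) := by
  have h := pow_div_factorial_le_exp (1 + u) (by linarith) K
  rw [div_le_iff₀ (by positivity)] at h
  calc (1 + u) ^ K * exp (-u ^ 2 / 2)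
      ≤ exp (1 + u) * K.factorial * exp (-u ^ 2 / 2) := by gcongr
    _ = K.factorial * exp (1 + u + -u ^ 2 / 2) := by rw [exp_add _ (-u ^ 2 / 2)]; ring
    _ ≤ _ := by
      gcongr
      nlinarith [sq_nonneg (u - 1)]

/-- Gaussian decay absorbs all powers of `z`, and leaves a power of `√x + |z|` to spare. -/
theorem exists_sqrt_add_abs_pow_mul_le (p b m l : ℕ) (hpb : p + b ≤ 2 * m) :
    ∃ C, 0 < C ∧ ∀ x z : ℝ, 1 ≤ x →
      (√x + |z|) ^ b * (|z| ^ p * x ^ (-((m : ℝ) + 1 / 2)) *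
        ((1 + z ^ 2 / x) ^ l * exp (-z ^ 2 / (2 * x)))) ≤ C * x ^ (-(1 / 2) : ℝ) := by
  refine ⟨(b + p + 2 * l).factorial * exp (3 / 2), by positivity, fun x z hx => ?_⟩
  have hx0 : 0 < x := by linarith
  have hS : 1 ≤ √x := one_le_sqrt.2 hx
  have hS0 : 0 < √x := by linarith
  obtain ⟨u, hu⟩ : ∃ u, u = |z| / √x := ⟨_, rfl⟩
  have hu0 : 0 ≤ u := hu ▸ by positivity
  have hz : |z| = √x * u := by rw [hu]; field_simp
  have hz2 : z ^ 2 = x * u ^ 2 := by rw [← sq_abs, hz, mul_pow, sq_sqrt hx0.le]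
  have hxm : x ^ (-((m : ℝ) + 1 / 2)) = (√x ^ (2 * m))⁻¹ * x ^ (-(1 / 2) : ℝ) := by
    rw [neg_add, rpow_add hx0, rpow_neg hx0.le, rpow_natCast, pow_mul, sq_sqrt hx0.le]
  have e1 : z ^ 2 / x = u ^ 2 := by rw [hz2]; field_simp
  have e2 : -z ^ 2 / (2 * x) = -u ^ 2 / 2 := by rw [hz2]; field_simp
  have hpow : √x ^ (b + p) * (√x ^ (2 * m))⁻¹ ≤ 1 := by
    rw [← div_eq_mul_inv]
    exact div_le_one_of_le₀ (pow_le_pow_right₀ hS (by omega)) (by positivity)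
  rw [hxm, e1, e2, hz]
  calc _ = (√x ^ (b + p) * (√x ^ (2 * m))⁻¹) *
        ((1 + u) ^ b * u ^ p * (1 + u ^ 2) ^ l * exp (-u ^ 2 / 2)) * x ^ (-(1 / 2) : ℝ) := by
        rw [show √x + √x * u = √x * (1 + u) by ring, mul_pow, mul_pow, pow_add]; ring
    _ ≤ 1 * ((1 + u) ^ b * (1 + u) ^ p * ((1 + u) ^ 2) ^ l * exp (-u ^ 2 / 2)) *
        x ^ (-(1 / 2) : ℝ) := by
        gcongr
        · linarith
        · nlinarith
    _ = ((1 + u) ^ (b + p + 2 * l) * exp (-u ^ 2 / 2)) * x ^ (-(1 / 2) : ℝ) := by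
        rw [pow_add, pow_add, pow_mul]; ring
    _ ≤ _ := by
        exact mul_le_mul_of_nonneg_right (one_add_pow_mul_exp_neg_sq_le _ hu0) (by positivity)

theorem sum_sub_rpow_neg_half_le (n : ℕ) :
    ∑ k ∈ range n, ((n : ℝ) - k) ^ (-(1 / 2) : ℝ) ≤ 2 * √n := by
  induction n with
  | zero => simp
  | succ n ih =>
    rw [sum_range_succ']
    have h : √((n : ℝ) + 1) ^ 2 = n + 1 := sq_sqrt (by positivity)
    have h' : √(n : ℝ) ^ 2 = n := sq_sqrt (by positivity)
    have hpos : 0 < √((n : ℝ) + 1) := by positivity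
    have hle : √(n : ℝ) ≤ √((n : ℝ) + 1) := sqrt_le_sqrt (by linarith)
    have hinv : (√((n : ℝ) + 1))⁻¹ ≤ 2 * √((n : ℝ) + 1) - 2 * √n := by
      rw [inv_le_iff_one_le_mul₀ hpos]
      nlinarith
    push_cast
    simp only [add_sub_add_right_eq_sub, sub_zero]
    rw [rpow_neg (by positivity) (1 / 2), ← sqrt_eq_rpow]
    linarith

theorem sub_rpow_mul_exp_eq_laguerreKernel (β z : ℝ) {n k : ℕ} (hk : k < n) :
    ((n : ℝ) - k) ^ (-β) * exp (-z ^ 2 / (2 * ((n : ℝ) - k))) =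
      (n : ℝ) ^ (-β) * laguerreKernel β (z ^ 2 / n) (k / n) := by
  have hn : (0 : ℝ) < n := by exact_mod_cast (Nat.zero_le k).trans_lt hk
  have hkn : (k : ℝ) < n := by exact_mod_cast hk
  have hne : (n : ℝ) - k ≠ 0 := by linarith
  have h : 1 - (k : ℝ) / n = (n - k) / n := by field_simp
  have h0 : 0 ≤ 1 - (k : ℝ) / n := by rw [h]; exact div_nonneg (by linarith) hn.le
  rw [laguerreKernel, ← mul_assoc, ← mul_rpow hn.le h0, h, mul_div_cancel₀ _ hn.ne']
  congr 2
  field_simp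

section Weights

variable {v : ℕ → ℝ} {C₁ : ℝ} {a : ℕ}

theorem weight_zero (hv : ∀ k : ℕ, |v k| ≤ C₁ * (k : ℝ) ^ (-((a : ℝ) / 2 + 7 / 4))) :
    v 0 = 0 := by
  have h := hv 0
  have ha : -((a : ℝ) / 2 + 7 / 4) ≠ 0 := by
    have : (0 : ℝ) < (a : ℝ) / 2 + 7 / 4 := by positivity
    linarith
  rw [Nat.cast_zero, zero_rpow ha, mul_zero] at h
  exact abs_nonpos_iff.1 h

theorem summable_abs_weight_mul_rpow
    (hv : ∀ k : ℕ, |v k| ≤ C₁ * (k : ℝ) ^ (-((a : ℝ) / 2 + 7 / 4))) :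
    Summable fun k : ℕ => |v k| * (k : ℝ) ^ (((a : ℝ) + 1) / 2) := by
  have hs : Summable fun k : ℕ => C₁ * (k : ℝ) ^ (-(5 / 4) : ℝ) :=
    (summable_nat_rpow.2 (by norm_num)).mul_left C₁
  refine Summable.of_nonneg_of_le (fun k => by positivity) (fun k => ?_) hs
  rcases Nat.eq_zero_or_pos k with rfl | hk
  · simp [weight_zero hv]
  · have hk' : (0 : ℝ) < k := by exact_mod_cast hk
    calc |v k| * (k : ℝ) ^ (((a : ℝ) + 1) / 2)
        ≤ C₁ * (k : ℝ) ^ (-((a : ℝ) / 2 + 7 / 4)) * (k : ℝ) ^ (((a : ℝ) + 1) / 2) := by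
          gcongr
          exact hv k
      _ = C₁ * (k : ℝ) ^ (-(5 / 4) : ℝ) := by
          rw [mul_assoc, ← rpow_add hk']
          congr 2
          ring

theorem summable_weight_mul_pow
    (hv : ∀ k : ℕ, |v k| ≤ C₁ * (k : ℝ) ^ (-((a : ℝ) / 2 + 7 / 4))) {η : ℕ} (hη : η ≤ a / 2) :
    Summable fun k : ℕ => v k * (k : ℝ) ^ η := by
  refine Summable.of_norm_bounded (summable_abs_weight_mul_rpow hv) fun k => ?_
  rcases Nat.eq_zero_or_pos k with rfl | hk
  · simp [weight_zero hv]
  · have hk' : (1 : ℝ) ≤ k := by exact_mod_cast hk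
    have hη' : 2 * (η : ℝ) ≤ a := by
      have : 2 * η ≤ a := by omega
      exact_mod_cast this
    rw [norm_mul, norm_eq_abs, norm_of_nonneg (by positivity), ← rpow_natCast]
    gcongr
    linarith

/-- The contribution of the indices `k > n / 2` to the weighted sum. -/
theorem exists_sum_upper_half_le (p b m : ℕ) (hpb : p + b ≤ 2 * m) (hC₁ : 0 < C₁)
    (hv : ∀ k : ℕ, |v k| ≤ C₁ * (k : ℝ) ^ (-((a : ℝ) / 2 + 7 / 4))) :
    ∃ C, 0 < C ∧ ∀ n : ℕ, 1 ≤ n → ∀ z : ℝ,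
      |z ^ p * ∑ k ∈ range n with ¬ ((k : ℕ) : ℝ) / n ≤ 1 / 2, v k *
          (((n : ℝ) - k) ^ (-((m : ℝ) + 1 / 2)) * exp (-z ^ 2 / (2 * ((n : ℝ) - k))))| ≤
        C / (√n ^ (a + 2) * (1 + |z|) ^ b) := by
  obtain ⟨C₂, hC₂, h₂⟩ := exists_sqrt_add_abs_pow_mul_le p b m 0 hpb
  refine ⟨C₁ * 2 ^ (((a : ℝ) + 3) / 2) * C₂ * 2, by positivity, fun n hn z => ?_⟩
  have hn0 : (0 : ℝ) < n := by exact_mod_cast hn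
  have hz : 0 < 1 + |z| := by positivity
  rw [mul_sum]
  refine (abs_sum_le_sum_abs _ _).trans ?_
  calc _ ≤ ∑ k ∈ range n with ¬ ((k : ℕ) : ℝ) / n ≤ 1 / 2,
        C₁ * 2 ^ (((a : ℝ) + 3) / 2) * (n : ℝ) ^ (-(((a : ℝ) + 3) / 2)) *
          (C₂ * ((n : ℝ) - k) ^ (-(1 / 2) : ℝ) / (1 + |z|) ^ b) := by
        refine sum_le_sum fun k hk => ?_
        rw [mem_filter, mem_range, not_le, lt_div_iff₀ hn0] at hk
        obtain ⟨hkn, hk2⟩ := hk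
        have hk1 : (1 : ℝ) ≤ k := by
          have : (0 : ℝ) < k := by linarith
          exact_mod_cast this
        have hx1 : (1 : ℝ) ≤ (n : ℝ) - k := by
          have : (k : ℝ) + 1 ≤ n := by exact_mod_cast hkn
          linarith
        have hx0 : (0 : ℝ) < (n : ℝ) - k := by linarith
        have hvk : |v k| ≤ C₁ * 2 ^ (((a : ℝ) + 3) / 2) * (n : ℝ) ^ (-(((a : ℝ) + 3) / 2)) := by
          refine (hv k).trans ?_
          rw [mul_assoc]
          refine mul_le_mul_of_nonneg_left ?_ hC₁.le
          calc (k : ℝ) ^ (-((a : ℝ) / 2 + 7 / 4)) ≤ (k : ℝ) ^ (-(((a : ℝ) + 3) / 2)) :=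
                rpow_le_rpow_of_exponent_le hk1 (by linarith)
            _ ≤ ((n : ℝ) / 2) ^ (-(((a : ℝ) + 3) / 2)) :=
                rpow_le_rpow_of_nonpos (by positivity) (by linarith)
                  (neg_nonpos.2 (by positivity))
            _ = _ := by
                rw [div_rpow hn0.le zero_le_two, rpow_neg zero_le_two, div_inv_eq_mul, mul_comm]
        have hG : |z| ^ p * (((n : ℝ) - k) ^ (-((m : ℝ) + 1 / 2)) *
            exp (-z ^ 2 / (2 * ((n : ℝ) - k)))) ≤
            C₂ * ((n : ℝ) - k) ^ (-(1 / 2) : ℝ) / (1 + |z|) ^ b := by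
          rw [le_div_iff₀ (by positivity), mul_comm, ← mul_assoc (|z| ^ p)]
          refine le_trans ?_ (h₂ _ z hx1)
          rw [pow_zero, one_mul]
          gcongr
          exact one_le_sqrt.2 hx1
        rw [abs_mul, abs_mul, abs_pow, mul_left_comm]
        rw [abs_of_pos (by positivity : 0 < ((n : ℝ) - k) ^ (-((m : ℝ) + 1 / 2)) *
            exp (-z ^ 2 / (2 * ((n : ℝ) - k))))]
        exact mul_le_mul hvk hG (by positivity) (by positivity)
    _ ≤ ∑ k ∈ range n, C₁ * 2 ^ (((a : ℝ) + 3) / 2) * (n : ℝ) ^ (-(((a : ℝ) + 3) / 2)) *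
          (C₂ * ((n : ℝ) - k) ^ (-(1 / 2) : ℝ) / (1 + |z|) ^ b) := by
        refine sum_le_sum_of_subset_of_nonneg (filter_subset _ _) fun k hk _ => ?_
        have : (k : ℝ) ≤ n := by exact_mod_cast (mem_range.1 hk).le
        have : 0 ≤ ((n : ℝ) - k) ^ (-(1 / 2) : ℝ) := rpow_nonneg (by linarith) _
        positivity
    _ = C₁ * 2 ^ (((a : ℝ) + 3) / 2) * (n : ℝ) ^ (-(((a : ℝ) + 3) / 2)) *
          (C₂ / (1 + |z|) ^ b) * ∑ k ∈ range n, ((n : ℝ) - k) ^ (-(1 / 2) : ℝ) := by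
        rw [mul_sum]
        exact sum_congr rfl fun k _ => by ring
    _ ≤ C₁ * 2 ^ (((a : ℝ) + 3) / 2) * (n : ℝ) ^ (-(((a : ℝ) + 3) / 2)) *
          (C₂ / (1 + |z|) ^ b) * (2 * √n) := by
        gcongr
        exact sum_sub_rpow_neg_half_le n
    _ = _ := by
        have hpow : (n : ℝ) ^ (-(((a : ℝ) + 3) / 2)) = (√n ^ (a + 3))⁻¹ := by
          rw [rpow_neg hn0.le, sqrt_eq_rpow, ← rpow_natCast, ← rpow_mul hn0.le]
          push_cast
          ring_nf
        have hS : √(n : ℝ) ≠ 0 := (sqrt_pos.2 hn0).ne'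
        rw [hpow, pow_succ √(n : ℝ) (a + 2)]
        field_simp

/-- The weighted sum over `k ≤ n / 2` compared with the full expansion. -/
theorem exists_tsum_lower_half_sub_le (p b m : ℕ) (hpb : p + b ≤ 2 * m)
    (hv : ∀ k : ℕ, |v k| ≤ C₁ * (k : ℝ) ^ (-((a : ℝ) / 2 + 7 / 4))) :
    ∃ C, 0 ≤ C ∧ ∀ n : ℕ, 1 ≤ n → ∀ z : ℝ,
      |z ^ p * ((n : ℝ) ^ (-((m : ℝ) + 1 / 2)) * ((∑ k ∈ range n with ((k : ℕ) : ℝ) / n ≤ 1 / 2,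
          v k * laguerreKernel (m + 1 / 2) (z ^ 2 / n) (k / n)) -
        exp (-z ^ 2 / (2 * n)) * ∑ η ∈ range (a / 2 + 1), (∑' k, v k * (k : ℝ) ^ η) *
          (laguerreCoeff η (m + 1 / 2)).eval (z ^ 2 / n) * ((n : ℝ) ^ η)⁻¹))| ≤
        C / √n ^ (a + b + 2) := by
  obtain ⟨C₂, hC₂, h₂⟩ := exists_sqrt_add_abs_pow_mul_le p b m (a / 2 + 1) hpb
  have hL : 2 * (a / 2) ≤ a ∧ a ≤ 2 * (a / 2) + 1 := by omega
  have hL₁ : 2 * ((a / 2 : ℕ) : ℝ) ≤ a := by exact_mod_cast hL.1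
  have hL₂ : (a : ℝ) ≤ 2 * ((a / 2 : ℕ) : ℝ) + 1 := by exact_mod_cast hL.2
  obtain ⟨C₃, hC₃, h₃⟩ := exists_truncated_laguerreKernel_sub_sum_le (a / 2)
    (((a : ℝ) + 1) / 2) (m + 1 / 2) (by positivity) (by linarith) (by linarith)
  have hW := summable_abs_weight_mul_rpow hv
  set W := ∑' k : ℕ, |v k| * (k : ℝ) ^ (((a : ℝ) + 1) / 2) with hWdef
  have hW0 : 0 ≤ W := tsum_nonneg fun k => by positivity
  refine ⟨W * C₃ * C₂, by positivity, fun n hn z => ?_⟩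
  have hn0 : (0 : ℝ) < n := by exact_mod_cast hn
  have hn1 : (1 : ℝ) ≤ n := by exact_mod_cast hn
  set y := z ^ 2 / (n : ℝ) with hy
  have hy0 : 0 ≤ y := by positivity
  have hexp : -z ^ 2 / (2 * (n : ℝ)) = -y / 2 := by rw [hy]; field_simp
  have hlow : HasSum (fun k : ℕ => v k *
      (if (k : ℝ) / n ≤ 1 / 2 then laguerreKernel (m + 1 / 2) y (k / n) else 0))
      (∑ k ∈ range n with ((k : ℕ) : ℝ) / n ≤ 1 / 2, v k * laguerreKernel (m + 1 / 2) y (k / n)) := by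
    rw [sum_filter]
    simp only [mul_ite, mul_zero]
    refine hasSum_sum_of_ne_finset_zero fun k hk => if_neg ?_
    have : (n : ℝ) ≤ k := by exact_mod_cast not_lt.1 (mt mem_range.2 hk)
    rw [not_le, lt_div_iff₀ hn0]
    linarith
  have hfull : HasSum (fun k : ℕ => v k * (exp (-y / 2) * ∑ η ∈ range (a / 2 + 1),
      (laguerreCoeff η (m + 1 / 2)).eval y * ((k : ℝ) / n) ^ η))
      (exp (-y / 2) * ∑ η ∈ range (a / 2 + 1), (∑' k, v k * (k : ℝ) ^ η) *
        (laguerreCoeff η (m + 1 / 2)).eval y * ((n : ℝ) ^ η)⁻¹) := by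
    have h := (hasSum_sum fun η (hη : η ∈ range (a / 2 + 1)) =>
      (((summable_weight_mul_pow hv (Nat.lt_succ_iff.1 (mem_range.1 hη))).hasSum.mul_right
        ((laguerreCoeff η (m + 1 / 2)).eval y)).mul_right ((n : ℝ) ^ η)⁻¹)).mul_left
          (exp (-y / 2))
    refine h.congr_fun fun k => ?_
    rw [mul_left_comm, mul_sum]
    congr 1
    refine sum_congr rfl fun η _ => ?_
    rw [div_pow]
    ring
  have hdiff := (hlow.sub hfull).norm_le_of_bounded
    (hW.hasSum.mul_right (C₃ * (n : ℝ) ^ (-(((a : ℝ) + 1) / 2)) *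
      ((1 + y) ^ (a / 2 + 1) * exp (-y / 2)))) fun k => ?_
  · have hS : 0 < √(n : ℝ) := sqrt_pos.2 hn0
    have hG : |z| ^ p * (n : ℝ) ^ (-((m : ℝ) + 1 / 2)) *
        ((1 + y) ^ (a / 2 + 1) * exp (-y / 2)) ≤ C₂ * (n : ℝ) ^ (-(1 / 2) : ℝ) / √n ^ b := by
      rw [le_div_iff₀ (by positivity), mul_comm, ← hexp]
      refine le_trans ?_ (h₂ _ z hn1)
      gcongr
      exact le_add_of_nonneg_right (abs_nonneg z)
    have hpow : (n : ℝ) ^ (-(((a : ℝ) + 1) / 2)) * (n : ℝ) ^ (-(1 / 2) : ℝ) =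
        (√n ^ (a + 2))⁻¹ := by
      rw [← rpow_add hn0, sqrt_eq_rpow, ← rpow_natCast, ← rpow_mul hn0.le, ← rpow_neg hn0.le]
      push_cast
      ring_nf
    rw [hexp, abs_mul, abs_mul, abs_pow, abs_of_pos (rpow_pos_of_pos hn0 _)]
    calc _ ≤ |z| ^ p * ((n : ℝ) ^ (-((m : ℝ) + 1 / 2)) * (W * (C₃ *
          (n : ℝ) ^ (-(((a : ℝ) + 1) / 2)) * ((1 + y) ^ (a / 2 + 1) * exp (-y / 2))))) := by
          gcongr
          exact hdiff
      _ = W * C₃ * (n : ℝ) ^ (-(((a : ℝ) + 1) / 2)) * (|z| ^ p *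
          (n : ℝ) ^ (-((m : ℝ) + 1 / 2)) * ((1 + y) ^ (a / 2 + 1) * exp (-y / 2))) := by ring
      _ ≤ W * C₃ * (n : ℝ) ^ (-(((a : ℝ) + 1) / 2)) *
          (C₂ * (n : ℝ) ^ (-(1 / 2) : ℝ) / √n ^ b) := by gcongr
      _ = W * C₃ * C₂ * ((n : ℝ) ^ (-(((a : ℝ) + 1) / 2)) * (n : ℝ) ^ (-(1 / 2) : ℝ)) /
          √n ^ b := by ring
      _ = _ := by
          rw [hpow, show a + b + 2 = a + 2 + b by ring, pow_add _ (a + 2) b]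
          field_simp
  · rw [← mul_sub, norm_mul, norm_eq_abs, norm_eq_abs, mul_assoc]
    rcases Nat.eq_zero_or_pos k with rfl | hk
    · simp [weight_zero hv]
    · have hk0 : (0 : ℝ) < k := by exact_mod_cast hk
      refine mul_le_mul_of_nonneg_left ((h₃ y (k / n) hy0 (by positivity)).trans_eq ?_)
        (abs_nonneg _)
      rw [div_rpow hk0.le hn0.le, rpow_neg hn0.le]
      ring

/-- Expansion of a weighted sum of Gaussian kernels, with the moments of the weights as
coefficients. -/
theorem exists_weighted_sum_sub_expansion_le (p b m : ℕ) (hpb : p + b ≤ 2 * m) (hC₁ : 0 < C₁)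
    (hv : ∀ k : ℕ, |v k| ≤ C₁ * (k : ℝ) ^ (-((a : ℝ) / 2 + 7 / 4))) :
    ∃ C, 0 < C ∧ ∀ n : ℕ, 1 ≤ n → ∀ z : ℝ,
      |z ^ p * (∑ k ∈ range n, v k * ((n : ℝ) - k) ^ (-((m : ℝ) + 1 / 2)) *
            exp (-z ^ 2 / (2 * ((n : ℝ) - k)))) -
          z ^ p / (n : ℝ) ^ ((m : ℝ) + 1 / 2) * exp (-z ^ 2 / (2 * n)) *
            ∑ η ∈ range (a / 2 + 1), (∑' k, v k * (k : ℝ) ^ η) *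
              (laguerreCoeff η (m + 1 / 2)).eval (z ^ 2 / n) * ((n : ℝ) ^ η)⁻¹| ≤
        C / min (√n) (1 + |z|) ^ (a + b + 2) := by
  obtain ⟨C₂, hC₂, h₂⟩ := exists_sum_upper_half_le p b m hpb hC₁ hv
  obtain ⟨C₃, hC₃, h₃⟩ := exists_tsum_lower_half_sub_le p b m hpb hv
  refine ⟨C₂ + C₃, by positivity, fun n hn z => ?_⟩
  have hn0 : (0 : ℝ) < n := by exact_mod_cast hn
  have hS : 0 < √(n : ℝ) := sqrt_pos.2 hn0
  have hM : 0 < min (√(n : ℝ)) (1 + |z|) := lt_min hS (by positivity)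
  have hlow : ∑ k ∈ range n with ((k : ℕ) : ℝ) / n ≤ 1 / 2, v k *
      (((n : ℝ) - k) ^ (-((m : ℝ) + 1 / 2)) * exp (-z ^ 2 / (2 * ((n : ℝ) - k)))) =
      (n : ℝ) ^ (-((m : ℝ) + 1 / 2)) * ∑ k ∈ range n with ((k : ℕ) : ℝ) / n ≤ 1 / 2,
        v k * laguerreKernel (m + 1 / 2) (z ^ 2 / n) (k / n) := by
    rw [mul_sum]
    refine sum_congr rfl fun k hk => ?_
    rw [sub_rpow_mul_exp_eq_laguerreKernel _ _ (mem_range.1 (mem_filter.1 hk).1), mul_left_comm]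
  have key := (abs_add_le _ _).trans (add_le_add (h₂ n hn z) (h₃ n hn z))
  refine le_trans (le_of_eq ?_) (key.trans ?_)
  · simp only [mul_assoc (v _)]
    rw [← sum_filter_add_sum_filter_not (range n) (fun k : ℕ => (k : ℝ) / n ≤ 1 / 2), hlow,
      rpow_neg hn0.le]
    congr 1
    ring
  · rw [add_div]
    refine add_le_add ?_ ?_
    · rw [show a + b + 2 = a + 2 + b by ring, pow_add _ (a + 2) b]
      gcongr
      · exact min_le_left _ _
      · exact min_le_right _ _
    · gcongr
      exact min_le_left _ _

end Weights

theorem log_pow_le_mul_rpow_quarter (L : ℕ) {x : ℝ} (hx : 1 ≤ x) :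
    log x ^ L ≤ (4 * ((L : ℝ) + 1)) ^ L * x ^ (1 / 4 : ℝ) := by
  have hL : (0 : ℝ) < 4 * ((L : ℝ) + 1) := by positivity
  have h : log x ≤ 4 * ((L : ℝ) + 1) * x ^ (4 * ((L : ℝ) + 1))⁻¹ := by
    have := log_le_rpow_div (zero_le_one.trans hx) (inv_pos.2 hL)
    rwa [div_inv_eq_mul, mul_comm] at this
  refine (pow_le_pow_left₀ (log_nonneg hx) h L).trans ?_
  rw [mul_pow, ← rpow_natCast (x ^ _), ← rpow_mul (by linarith)]
  gcongr
  rw [inv_mul_le_iff₀ hL]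
  linarith

/-- Lemma 14: expansion for sums weighted by remainder terms `v_k`. -/
theorem stmt_19 (r j q s ν μ : ℕ) (hr : 1 ≤ r) (hsq : s ≤ q) (hq : q ≤ 2 * j)
    (hsum : s + ν + 2 * μ ≤ r)
    (v : ℕ → ℝ) (C₀ : ℝ) (hC₀ : 0 < C₀)
    (hv : ∀ k : ℕ, 2 ≤ k →
      |v k| ≤ C₀ * Real.log k ^ ((r - s - ν - 2 * μ) / 2) /
        (k : ℝ) ^ (((r : ℝ) - s - ν - 2 * μ) / 2 + 2)) :
    ∃ (H : ℕ → Polynomial ℝ) (C : ℝ), 0 < C ∧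
      (∀ η, η ≤ (r + 3) / 2 → (H η).natDegree ≤ η) ∧
      ∀ n : ℕ, 4 ≤ n → ∀ z : ℝ,
        |z ^ (q - s + ν) *
            (∑ k ∈ Finset.Icc 2 (n - 1),
              v k * ((n : ℝ) - k) ^ (-((j : ℝ) + ν + μ + 1 / 2)) *
                Real.exp (-z ^ 2 / (2 * ((n : ℝ) - k))))
          - z ^ (q - s + ν) / (n : ℝ) ^ ((j : ℝ) + ν + μ + 1 / 2) *
              Real.exp (-z ^ 2 / (2 * n)) *
              ∑ η ∈ Finset.range ((r + 3) / 2 + 1),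
                (H η).eval (z ^ 2 / n) * ((n : ℝ) ^ η)⁻¹|
        ≤ C / (min (Real.sqrt n) (1 + |z|)) ^ (r + 2) := by
  obtain ⟨a, ha⟩ : ∃ a, a = r - s - ν - 2 * μ := ⟨_, rfl⟩
  have har : r = a + (s + ν + 2 * μ) := by omega
  have hacast : (r : ℝ) - s - ν - 2 * μ = a := by rw [har]; push_cast; ring
  rw [← ha, hacast] at hv
  obtain ⟨w, hw⟩ : ∃ w : ℕ → ℝ, w = fun k => if 2 ≤ k then v k else 0 := ⟨_, rfl⟩
  have hC₁ : 0 < C₀ * (4 * (((a / 2 : ℕ) : ℝ) + 1)) ^ (a / 2) := by positivity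
  have hwb : ∀ k : ℕ, |w k| ≤ C₀ * (4 * (((a / 2 : ℕ) : ℝ) + 1)) ^ (a / 2) *
      (k : ℝ) ^ (-((a : ℝ) / 2 + 7 / 4)) := by
    intro k
    simp only [hw]
    split_ifs with hk
    · have hk1 : (1 : ℝ) ≤ k := by exact_mod_cast one_le_two.trans hk
      have hk0 : (0 : ℝ) < k := by linarith
      refine (hv k hk).trans ?_
      calc C₀ * log k ^ (a / 2) / (k : ℝ) ^ ((a : ℝ) / 2 + 2)
          ≤ C₀ * ((4 * (((a / 2 : ℕ) : ℝ) + 1)) ^ (a / 2) * (k : ℝ) ^ (1 / 4 : ℝ)) /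
            (k : ℝ) ^ ((a : ℝ) / 2 + 2) := by
            gcongr
            exact log_pow_le_mul_rpow_quarter _ hk1
        _ = C₀ * (4 * (((a / 2 : ℕ) : ℝ) + 1)) ^ (a / 2) *
            ((k : ℝ) ^ (1 / 4 : ℝ) / (k : ℝ) ^ ((a : ℝ) / 2 + 2)) := by ring
        _ = _ := by
            rw [← rpow_sub hk0]
            congr 2
            ring
    · rw [abs_zero]
      positivity
  obtain ⟨C, hC, h⟩ := exists_weighted_sum_sub_expansion_le (q - s + ν) (s + ν + 2 * μ)
    (j + ν + μ) (by omega) hC₁ hwb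
  refine ⟨fun η => if η < a / 2 + 1 then Polynomial.C (∑' k, w k * (k : ℝ) ^ η) *
    laguerreCoeff η ((j + ν + μ : ℕ) + 1 / 2) else 0, C, hC, fun η _ => ?_, fun n hn z => ?_⟩
  · dsimp only
    split_ifs
    · exact (Polynomial.natDegree_C_mul_le _ _).trans (natDegree_laguerreCoeff_le _ _)
    · simp
  · have hsumw : ∑ k ∈ Icc 2 (n - 1), v k * ((n : ℝ) - k) ^ (-((j : ℝ) + ν + μ + 1 / 2)) *
        exp (-z ^ 2 / (2 * ((n : ℝ) - k))) =
        ∑ k ∈ range n, w k * ((n : ℝ) - k) ^ (-((j : ℝ) + ν + μ + 1 / 2)) *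
          exp (-z ^ 2 / (2 * ((n : ℝ) - k))) := by
      have hIcc : Icc 2 (n - 1) = {k ∈ range n | 2 ≤ k} := by
        ext k
        simp only [mem_Icc, mem_filter, mem_range]
        omega
      rw [hIcc, sum_filter]
      refine sum_congr rfl fun k _ => ?_
      simp only [hw, ite_mul, zero_mul]
    have hsumH : ∑ η ∈ range ((r + 3) / 2 + 1), Polynomial.eval (z ^ 2 / n)
        (if η < a / 2 + 1 then Polynomial.C (∑' k, w k * (k : ℝ) ^ η) *
          laguerreCoeff η ((j + ν + μ : ℕ) + 1 / 2) else 0) * ((n : ℝ) ^ η)⁻¹ =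
        ∑ η ∈ range (a / 2 + 1), (∑' k, w k * (k : ℝ) ^ η) *
          (laguerreCoeff η ((j + ν + μ : ℕ) + 1 / 2)).eval (z ^ 2 / n) * ((n : ℝ) ^ η)⁻¹ := by
      have hsub : range (a / 2 + 1) ⊆ range ((r + 3) / 2 + 1) := range_subset_range.2 (by omega)
      rw [← sum_subset hsub fun η _ hη => by rw [if_neg (mt mem_range.2 hη)]; simp]
      refine sum_congr rfl fun η hη => ?_
      rw [if_pos (mem_range.1 hη), Polynomial.eval_mul, Polynomial.eval_C]
    have hmain := h n (by omega) z
    rw [hsumw, hsumH]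
    rw [← har] at hmain
    push_cast at hmain ⊢
    exact hmain
end
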